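/- Let G be a finite 2-generated group such that C2 × C2 is an epimorphic image of G. If the number of ordered pairs (x, y) ∈ G × G with ⟨x, y⟩ = G is strictly less than 6·|G|, then G is isomorphic to one of: C2 × C2, C4 × C2, D4 (dihedral of order 8), Q8 (quaternion of order 8), D6 (dihedral of order 12), or C2 × C2 × C3. -/

import Mathlib

namespace TwoGen

/-- `x, y` generate the group. -/
def Gen {G : Type*} [Group G] (x y : G) : Prop := Subgroup.closure {x, y} = ⊤

section basic
variable {G : Type*} [Group G]

theorem mem_cl_left (x y : G) : x ∈ Subgroup.closure ({x, y} : Set G) :=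
  Subgroup.subset_closure (by simp)

theorem mem_cl_right (x y : G) : y ∈ Subgroup.closure ({x, y} : Set G) :=
  Subgroup.subset_closure (by simp)

theorem Gen.eq_top {x y : G} (h : Gen x y) (H : Subgroup G) (hx : x ∈ H) (hy : y ∈ H) :
    H = ⊤ := by
  have : Subgroup.closure ({x, y} : Set G) ≤ H := by
    rw [Subgroup.closure_le]
    rintro z (rfl | rfl)
    · exact hx
    · exact hy
  rw [h] at this
  exact top_le_iff.mp this

theorem Gen.of_mem {x y u v : G} (h : Gen x y)
    (hx : x ∈ Subgroup.closure ({u, v} : Set G)) (hy : y ∈ Subgroup.closure ({u, v} : Set G)) :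
    Gen u v := h.eq_top _ hx hy

theorem Gen.of_mem' {x y u v : G} (h : Gen x y)
    (H : ∀ K : Subgroup G, u ∈ K → v ∈ K → x ∈ K ∧ y ∈ K) : Gen u v :=
  h.of_mem (H _ (mem_cl_left _ _) (mem_cl_right _ _)).1
    (H _ (mem_cl_left _ _) (mem_cl_right _ _)).2

theorem Gen.swap {x y : G} (h : Gen x y) : Gen y x :=
  h.of_mem' fun _ h1 h2 => ⟨h2, h1⟩

theorem Gen.mulRight {x y : G} (h : Gen x y) : Gen (x * y) y :=
  h.of_mem' fun K h1 h2 => ⟨by simpa using K.mul_mem h1 (K.inv_mem h2), h2⟩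

theorem Gen.invRight {x y : G} (h : Gen x y) : Gen x y⁻¹ :=
  h.of_mem' fun K h1 h2 => ⟨h1, by simpa using h2⟩

theorem Gen.rot {x y : G} (h : Gen x y) : Gen y (x * y)⁻¹ := h.mulRight.swap.invRight

theorem Gen.quart {x y : G} (h : Gen x y) : Gen y⁻¹ x := h.invRight.swap

theorem Gen.conj {x y : G} (h : Gen x y) (g : G) : Gen (g * x * g⁻¹) (g * y * g⁻¹) := by
  have := h.eq_top ((Subgroup.closure ({g * x * g⁻¹, g * y * g⁻¹} : Set G)).comap
    (MulAut.conj g).toMonoidHom) (by simpa using mem_cl_left _ _) (by simpa using mem_cl_right _ _)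
  unfold Gen
  rw [Subgroup.eq_top_iff']
  intro z
  have hz : g⁻¹ * z * g ∈ ((Subgroup.closure ({g * x * g⁻¹, g * y * g⁻¹} : Set G)).comap
    (MulAut.conj g).toMonoidHom) := by rw [this]; trivial
  simpa [mul_assoc] using hz

theorem Gen.map {x y : G} (h : Gen x y) {Q : Type*} [Group Q] (f : G →* Q)
    (hf : Function.Surjective f) : Gen (f x) (f y) := by
  have := h.eq_top ((Subgroup.closure ({f x, f y} : Set Q)).comap f)
    (by simpa using mem_cl_left _ _) (by simpa using mem_cl_right _ _)
  unfold Gen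
  rw [Subgroup.eq_top_iff']
  intro z
  obtain ⟨g, rfl⟩ := hf z
  have hz : g ∈ ((Subgroup.closure ({f x, f y} : Set Q)).comap f) := by rw [this]; trivial
  simpa using hz

theorem Gen.central {x y : G} (h : Gen x y) {g : G} (hx : Commute g x) (hy : Commute g y) :
    g ∈ Subgroup.center G := by
  have := h.eq_top (Subgroup.centralizer {g})
    (by rw [Subgroup.mem_centralizer_singleton_iff]; exact hx.symm)
    (by rw [Subgroup.mem_centralizer_singleton_iff]; exact hy.symm)
  rw [Subgroup.mem_center_iff]
  intro z
  have hz : z ∈ Subgroup.centralizer {g} := by rw [this]; trivial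
  rw [Subgroup.mem_centralizer_singleton_iff] at hz
  exact hz

theorem Gen.eq_one {x y : G} (h : Gen x y) (hZ : Subgroup.center G = ⊥) {g : G}
    (hx : Commute g x) (hy : Commute g y) : g = 1 := by
  have := h.central hx hy
  rwa [hZ, Subgroup.mem_bot] at this

theorem comm_conj_iff {g x : G} : Commute g x ↔ g * x * g⁻¹ = x := by
  rw [mul_inv_eq_iff_eq_mul]; rfl

variable (G) in
/-- Generating pairs. -/
abbrev Pairs := {p : G × G | Subgroup.closure {p.1, p.2} = ⊤}

/-- Simultaneous conjugacy of pairs. -/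
def Sim (x y u v : G) : Prop := ∃ g : G, g * x * g⁻¹ = u ∧ g * y * g⁻¹ = v

theorem Sim.refl (x y : G) : Sim x y x y := ⟨1, by simp, by simp⟩

theorem Sim.symm {x y u v : G} : Sim x y u v → Sim u v x y := by
  rintro ⟨g, rfl, rfl⟩
  exact ⟨g⁻¹, by group, by group⟩

theorem Sim.trans {x y u v a b : G} : Sim x y u v → Sim u v a b → Sim x y a b := by
  rintro ⟨g, rfl, rfl⟩ ⟨k, rfl, rfl⟩
  exact ⟨k * g, by group, by group⟩

variable (G) in
/-- The conjugacy setoid on generating pairs. -/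
def simSetoid : Setoid (Pairs G) where
  r p q := Sim p.1.1 p.1.2 q.1.1 q.1.2
  iseqv := ⟨fun _ => Sim.refl _ _, Sim.symm, Sim.trans⟩

variable (G) in
/-- Classes of generating pairs up to simultaneous conjugacy. -/
def Cls := Quotient (simSetoid G)

/-- Class of a generating pair. -/
def cls (x y : G) (h : Gen x y) : Cls G := Quotient.mk (simSetoid G) ⟨(x, y), h⟩

theorem cls_eq {x y u v : G} {h : Gen x y} {k : Gen u v} : cls x y h = cls u v k ↔ Sim x y u v :=
  ⟨fun e => Quotient.exact (s := simSetoid G) e, fun e => Quotient.sound (s := simSetoid G) e⟩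

theorem cls_ind (c : Cls G) : ∃ x y, ∃ h : Gen x y, c = cls x y h := by
  induction c using Quotient.inductionOn with
  | h p => exact ⟨p.1.1, p.1.2, p.2, rfl⟩

instance [Finite G] : Finite (Cls G) := by unfold Cls; infer_instance

theorem card_cls_mul_le [Finite G] (hZ : Subgroup.center G = ⊥) :
    Nat.card (Cls G) * Nat.card G ≤ Nat.card (Pairs G) := by
  rw [← Nat.card_prod]
  let F : Cls G × G → Pairs G := fun c =>
    ⟨(c.2 * (Quotient.out c.1).1.1 * c.2⁻¹, c.2 * (Quotient.out c.1).1.2 * c.2⁻¹),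
      Gen.conj (Quotient.out c.1).2 c.2⟩
  refine Nat.card_le_card_of_injective F ?_
  rintro ⟨c, g⟩ ⟨d, k⟩ e
  have e1 : g * (Quotient.out c).1.1 * g⁻¹ = k * (Quotient.out d).1.1 * k⁻¹ :=
    congrArg (fun p => p.1.1) e
  have e2 : g * (Quotient.out c).1.2 * g⁻¹ = k * (Quotient.out d).1.2 * k⁻¹ :=
    congrArg (fun p => p.1.2) e
  have hcd : c = d := by
    rw [← Quotient.out_eq c, ← Quotient.out_eq d]
    apply Quotient.sound
    refine ⟨k⁻¹ * g, ?_, ?_⟩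
    · calc _ = k⁻¹ * (g * (Quotient.out c).1.1 * g⁻¹) * k := by group
        _ = _ := by rw [e1]; group
    · calc _ = k⁻¹ * (g * (Quotient.out c).1.2 * g⁻¹) * k := by group
        _ = _ := by rw [e2]; group
  subst hcd
  have : k⁻¹ * g = 1 := by
    refine Gen.eq_one (Quotient.out c).2 hZ (comm_conj_iff.2 ?_) (comm_conj_iff.2 ?_)
    · calc _ = k⁻¹ * (g * (Quotient.out c).1.1 * g⁻¹) * k := by group
        _ = _ := by rw [e1]; group
    · calc _ = k⁻¹ * (g * (Quotient.out c).1.2 * g⁻¹) * k := by group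
        _ = _ := by rw [e2]; group
  rw [inv_mul_eq_one.mp this]

/-- lifting maps of pairs to classes -/
def clsMap (f : G → G → G × G) (hf : ∀ x y, Gen x y → Gen (f x y).1 (f x y).2)
    (hc : ∀ g x y, f (g * x * g⁻¹) (g * y * g⁻¹) =
      (g * (f x y).1 * g⁻¹, g * (f x y).2 * g⁻¹)) : Cls G → Cls G :=
  Quotient.map (sa := simSetoid G) (sb := simSetoid G)
    (fun p => ⟨f p.1.1 p.1.2, hf _ _ p.2⟩) (by
    rintro ⟨⟨x, y⟩, h⟩ ⟨⟨u, v⟩, k⟩ ⟨g, h1, h2⟩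
    simp only at h1 h2
    subst h1; subst h2
    refine ⟨g, ?_, ?_⟩
    · simp [hc]
    · simp [hc])

def cT : Cls G → Cls G := clsMap (fun x y => (x * y, y)) (fun _ _ h => h.mulRight)
  (by intros; ext <;> simp [mul_assoc])
def cW : Cls G → Cls G := clsMap (fun x y => (y, x)) (fun _ _ h => h.swap)
  (by intros; ext <;> simp)
def cE : Cls G → Cls G := clsMap (fun x y => (x, y⁻¹)) (fun _ _ h => h.invRight)
  (by intros; ext <;> simp [mul_assoc])

theorem cT_cls {x y : G} (h : Gen x y) : cT (cls x y h) = cls (x * y) y h.mulRight := rfl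
theorem cW_cls {x y : G} (h : Gen x y) : cW (cls x y h) = cls y x h.swap := rfl
theorem cE_cls {x y : G} (h : Gen x y) : cE (cls x y h) = cls x y⁻¹ h.invRight := rfl

theorem cls_congr {x y u v : G} (h : Gen x y) (k : Gen u v) (e1 : x = u) (e2 : y = v) :
    cls x y h = cls u v k := by subst e1; subst e2; rfl

theorem cW_cW (c : Cls G) : cW (cW c) = c := by
  obtain ⟨x, y, h, rfl⟩ := cls_ind c; rfl

theorem cE_cE (c : Cls G) : cE (cE c) = c := by
  obtain ⟨x, y, h, rfl⟩ := cls_ind c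
  rw [cE_cls, cE_cls]; exact cls_congr _ _ rfl (by simp)

theorem cT_cE_cT (c : Cls G) : cT (cE (cT c)) = cE c := by
  obtain ⟨x, y, h, rfl⟩ := cls_ind c
  rw [cT_cls, cE_cls, cT_cls, cE_cls]; exact cls_congr _ _ (by simp) rfl

theorem cT_inj : Function.Injective (cT : Cls G → Cls G) := by
  intro c d e
  have : cE (cT (cE (cT c))) = cE (cT (cE (cT d))) := by rw [e]
  simpa [cT_cE_cT, cE_cE] using this

/-- order three rotation -/
def cR (c : Cls G) : Cls G := cE (cW (cT c))
/-- order four rotation -/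
def cS (c : Cls G) : Cls G := cW (cE c)

theorem cR_cls {x y : G} (h : Gen x y) : cR (cls x y h) = cls y (x * y)⁻¹ h.rot := rfl
theorem cS_cls {x y : G} (h : Gen x y) : cS (cls x y h) = cls y⁻¹ x h.quart := rfl

theorem cR_three (c : Cls G) : cR (cR (cR c)) = c := by
  obtain ⟨x, y, h, rfl⟩ := cls_ind c
  rw [cR_cls, cR_cls, cR_cls]; exact cls_congr _ _ (by group) (by group)

theorem cS_four (c : Cls G) : cS (cS (cS (cS c))) = c := by
  obtain ⟨x, y, h, rfl⟩ := cls_ind c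
  rw [cS_cls, cS_cls, cS_cls, cS_cls]; exact cls_congr _ _ (by group) (by group)

end basic


section core
variable {G : Type*} [Group G]

/-- `y` commutes with its conjugates by small powers of `x` -/
def Com (x y : G) (k : ℕ) : Prop := ∀ i ≤ k, Commute y (x⁻¹ ^ i * y * x ^ i)

theorem commute_conj {a b : G} (h : Commute a b) (x : G) (i : ℕ) :
    Commute (x⁻¹ ^ i * a * x ^ i) (x⁻¹ ^ i * b * x ^ i) := by
  have hx : x ^ i * x⁻¹ ^ i = 1 := by simp
  show _ * _ = _ * _
  calc _ = x⁻¹ ^ i * a * (x ^ i * x⁻¹ ^ i) * b * x ^ i := by group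
    _ = x⁻¹ ^ i * (a * b) * x ^ i := by rw [hx]; group
    _ = x⁻¹ ^ i * (b * a) * x ^ i := by rw [h.eq]
    _ = x⁻¹ ^ i * b * (x ^ i * x⁻¹ ^ i) * a * x ^ i := by rw [hx]; group
    _ = _ := by group

theorem Com.step {x y t : G} {k : ℕ} (h : Com x y k) (ht : Commute t y)
    (hx : t * x * t⁻¹ = x * y) : Com x t (k + 1) := by
  set c : ℕ → G := fun i => x⁻¹ ^ i * t * x ^ i with hc
  have hy : ∀ i, x⁻¹ ^ i * y * x ^ i = c (i + 1) * (c i)⁻¹ := by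
    intro i
    have : y = x⁻¹ * (t * x * t⁻¹) := by rw [hx]; group
    rw [this, hc]; simp only [pow_succ']; group
  have shift : ∀ i j m, Commute (c i) (c j) → Commute (c (i + m)) (c (j + m)) := by
    intro i j m hij
    have := commute_conj hij x m
    simp only [hc] at this ⊢
    convert this using 1 <;> rw [pow_add, pow_add] <;> simp only [← mul_assoc, ← pow_add] <;>
      rw [add_comm] <;> simp only [mul_assoc, ← pow_add] <;> rw [add_comm]
  have c0 : c 0 = t := by simp [hc]
  have main : ∀ i, i ≤ k + 1 → ∀ j ≤ i, Commute (c 0) (c j) := by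
    intro i
    induction i with
    | zero => intro _ j hj; obtain rfl : j = 0 := by omega
              exact Commute.refl _
    | succ i ih =>
      intro hi j hj
      rcases Nat.lt_or_ge j (i + 1) with hlt | hge
      · exact ih (by omega) j (by omega)
      obtain rfl : j = i + 1 := by omega
      have IH := ih (by omega)
      have y0 := hy 0
      simp only [pow_zero, one_mul, mul_one, zero_add] at y0
      rcases Nat.eq_zero_or_pos i with rfl | hpos
      · have : c 1 = y * c 0 := by rw [y0]; group
        simp only [zero_add]
        rw [this]
        exact (c0 ▸ ht).mul_right (Commute.refl _)
      · have h1 : Commute y (c (i + 1) * (c i)⁻¹) := by rw [← hy]; exact h i (by omega)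
        have h2 : Commute (c 1) (c (i + 1)) := by
          have := shift 0 i 1 (IH i le_rfl); rwa [zero_add] at this
        have h3 : Commute (c 1) (c i) := by
          have := shift 0 (i - 1) 1 (IH (i - 1) (by omega))
          rwa [zero_add, Nat.sub_add_cancel hpos] at this
        have h4 : Commute (c 1) (c (i + 1) * (c i)⁻¹) := h2.mul_right h3.inv_right
        have h5 : Commute (c 0) (c (i + 1) * (c i)⁻¹) := by
          have : c 0 = y⁻¹ * c 1 := by rw [y0]; group
          rw [this]
          exact h1.inv_left.mul_left h4
        have h6 := h5.mul_right (IH i le_rfl)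
        simpa using h6
  intro i hi
  have := main i hi i le_rfl
  rwa [c0] at this

/-- commuting with all conjugates under powers of `x` yields an abelian normal subgroup -/
theorem exists_abelian {x y : G} (h : Gen x y)
    (hc : ∀ i : ℤ, Commute y (x⁻¹ ^ i * y * x ^ i)) :
    ∃ A : Subgroup G, A.Normal ∧ y ∈ A ∧ ∀ a ∈ A, ∀ b ∈ A, Commute a b := by
  set S : Set G := Set.range fun i : ℤ => x⁻¹ ^ i * y * x ^ i with hS
  have hxS : ∀ i : ℤ, x⁻¹ ^ i * y * x ^ i ∈ Subgroup.closure S :=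
    fun i => Subgroup.subset_closure ⟨i, rfl⟩
  have hyS : y ∈ Subgroup.closure S := by simpa using hxS 0
  refine ⟨Subgroup.closure S, ?_, hyS, ?_⟩
  · rw [← Subgroup.normalizer_eq_top_iff]
    refine h.eq_top _ ?_ (Subgroup.le_normalizer hyS)
    have key : ∀ z : ℤ, ∀ n ∈ Subgroup.closure S, x ^ z * n * (x ^ z)⁻¹ ∈ Subgroup.closure S := by
      intro z n hn
      induction hn using Subgroup.closure_induction with
      | mem n hn =>
        obtain ⟨i, rfl⟩ := hn
        have := hxS (i - z)
        convert this using 1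
        simp only [inv_zpow', zpow_sub, zpow_neg]; group
      | one => simp
      | mul a b _ _ ha hb =>
        have := Subgroup.mul_mem _ ha hb
        convert this using 1; group
      | inv a _ ha =>
        have := Subgroup.inv_mem _ ha
        convert this using 1; group
    rw [Subgroup.mem_normalizer_iff]
    intro n
    refine ⟨fun hn => by simpa using key 1 n hn, fun hn => ?_⟩
    have := key (-1) _ hn
    convert this using 1; group
  · have hcomm : ∀ a ∈ S, ∀ b ∈ S, a * b = b * a := by
      rintro _ ⟨i, rfl⟩ _ ⟨j, rfl⟩
      have := hc (j - i)
      have e : x⁻¹ ^ j * y * x ^ j = x⁻¹ ^ i * (x⁻¹ ^ (j - i) * y * x ^ (j - i)) * x ^ i := by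
        simp only [inv_zpow', zpow_sub, zpow_neg]; group
      simp only
      rw [e]
      set u := x⁻¹ ^ (j - i) * y * x ^ (j - i)
      calc _ = x⁻¹ ^ i * (y * u) * x ^ i := by group
        _ = x⁻¹ ^ i * (u * y) * x ^ i := by rw [this.eq]
        _ = _ := by group
    intro a ha b hb
    have h1 : Subgroup.closure S ≤ Subgroup.centralizer S := by
      rw [Subgroup.closure_le]
      intro a ha
      rw [SetLike.mem_coe, Subgroup.mem_centralizer_iff]
      intro b hb
      exact hcomm b hb a ha
    have h2 : Subgroup.closure S ≤ Subgroup.centralizer (Subgroup.closure S) := by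
      rw [Subgroup.centralizer_closure]; exact h1
    exact (Subgroup.mem_centralizer_iff.1 (h2 hb) a ha)

theorem exists_abelian_nat [Finite G] {x y : G} (h : Gen x y)
    (hc : ∀ i : ℕ, Commute y (x⁻¹ ^ i * y * x ^ i)) :
    ∃ A : Subgroup G, A.Normal ∧ y ∈ A ∧ ∀ a ∈ A, ∀ b ∈ A, Commute a b := by
  refine exists_abelian h fun i => ?_
  have := hc (i % (Nat.card G : ℤ)).toNat
  have hn : (0 : ℤ) < Nat.card G := by exact_mod_cast Nat.card_pos
  have hpow : ∀ g : G, g ^ (i % (Nat.card G : ℤ)).toNat = g ^ i := by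
    intro g
    rw [← zpow_natCast, Int.toNat_of_nonneg (Int.emod_nonneg _ hn.ne')]
    conv_rhs => rw [← Int.emod_add_mul_ediv i (Nat.card G)]
    rw [zpow_add, zpow_mul, zpow_natCast]; simp
  rwa [hpow, hpow] at this

/-- The iteration argument. -/
theorem iterate_abelian [Finite G] (𝓕 : G → G → Prop) (hG : ∀ x y, 𝓕 x y → Gen x y)
    (hF : ∀ x y, 𝓕 x y → ∃ t, Commute t y ∧ t * x * t⁻¹ = x * y ∧ 𝓕 x t)
    {x y : G} (h : 𝓕 x y) : ∃ u v : G, Gen u v ∧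
      ∃ A : Subgroup G, A.Normal ∧ v ∈ A ∧ ∀ a ∈ A, ∀ b ∈ A, Commute a b := by
  have key : ∀ k : ℕ, ∃ s, 𝓕 x s ∧ Com x s k := by
    intro k
    induction k with
    | zero => exact ⟨y, h, fun i hi => by obtain rfl : i = 0 := by omega
                                          simp⟩
    | succ k ih =>
      obtain ⟨s, hs, hcom⟩ := ih
      obtain ⟨t, h1, h2, h3⟩ := hF x s hs
      exact ⟨t, h3, hcom.step h1 h2⟩
  obtain ⟨s, hs, hcom⟩ := key (Nat.card G)
  refine ⟨x, s, hG _ _ hs, exists_abelian_nat (hG _ _ hs) fun i => ?_⟩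
  have hpos : 0 < Nat.card G := Nat.card_pos
  have := hcom (i % Nat.card G) (Nat.mod_lt _ hpos).le
  have hpow : ∀ g : G, g ^ (i % Nat.card G) = g ^ i := by
    intro g
    conv_rhs => rw [← Nat.mod_add_div i (Nat.card G)]
    rw [pow_add, pow_mul]; simp
  rwa [hpow, hpow] at this

/-- Two-term recursion: `a_{i+1} = a_i^2 a_{i-1}⁻¹`. -/
theorem abelian_of_rec [Finite G] {x y : G} (h : Gen x y)
    (h1 : Commute y (x⁻¹ * y * x))
    (h2 : (x⁻¹ ^ 2 * y * x ^ 2) * y = (x⁻¹ * y * x) ^ 2) :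
    ∃ A : Subgroup G, A.Normal ∧ y ∈ A ∧ ∀ a ∈ A, ∀ b ∈ A, Commute a b := by
  refine exists_abelian_nat h ?_
  have hrec : ∀ i : ℕ, x⁻¹ ^ (i + 2) * y * x ^ (i + 2) =
      (x⁻¹ ^ (i + 1) * y * x ^ (i + 1)) ^ 2 * (x⁻¹ ^ i * y * x ^ i)⁻¹ := by
    intro i
    have : x⁻¹ ^ 2 * y * x ^ 2 = (x⁻¹ * y * x) ^ 2 * y⁻¹ := by rw [← h2]; group
    calc _ = x⁻¹ ^ i * (x⁻¹ ^ 2 * y * x ^ 2) * x ^ i := by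
          rw [pow_add, pow_add x]
          have : x ^ i * x ^ 2 = x ^ 2 * x ^ i := by rw [← pow_add, add_comm, pow_add]
          rw [this]; group
      _ = x⁻¹ ^ i * ((x⁻¹ * y * x) ^ 2 * y⁻¹) * x ^ i := by rw [this]
      _ = _ := by
          simp only [pow_succ', pow_zero, mul_one]; group
  have : ∀ i : ℕ, Commute y (x⁻¹ ^ i * y * x ^ i) ∧
      Commute y (x⁻¹ ^ (i + 1) * y * x ^ (i + 1)) := by
    intro i
    induction i with
    | zero => simpa using h1
    | succ i ih =>
      refine ⟨ih.2, ?_⟩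
      rw [hrec]
      exact (ih.2.pow_right 2).mul_right ih.1.inv_right
  exact fun i => (this i).1

end core


section comb
variable {X : Type*}

theorem four_of_card [Finite X] (hX : Nat.card X ≤ 3) (a b c d : X) :
    a = b ∨ a = c ∨ a = d ∨ b = c ∨ b = d ∨ c = d := by
  by_contra hne
  push Not at hne
  obtain ⟨h1, h2, h3, h4, h5, h6⟩ := hne
  have : Function.Injective ![a, b, c, d] := by
    intro i j hij
    fin_cases i <;> fin_cases j <;> simp_all
  have := Nat.card_le_card_of_injective _ this
  simp at this
  omega

theorem fix_of_four {a b c : X} (hab : a ≠ b) (hac : a ≠ c) (hbc : b ≠ c) (hall : ∀ z, z = a ∨ z = b ∨ z = c)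
    (S : X → X) (hS : ∀ z, S (S (S (S z))) = z) : ∃ z, S z = z := by
  by_contra hne
  push Not at hne
  have h1 := hall (S a); have h2 := hall (S b); have h3 := hall (S c)
  have n1 := hne a; have n2 := hne b; have n3 := hne c
  have f1 := hS a; have f2 := hS b; have f3 := hS c
  rcases h1 with h1 | h1 | h1 <;> rcases h2 with h2 | h2 | h2 <;> rcases h3 with h3 | h3 | h3 <;>
    simp_all

theorem nofix_four {a b c : X} (hab : a ≠ b) (hac : a ≠ c) (hbc : b ≠ c) (hall : ∀ z, z = a ∨ z = b ∨ z = c)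
    (T : X → X) (hT : Function.Injective T) (hn : ∀ z, T z ≠ z) (z : X) :
    T (T (T (T z))) ≠ z := by
  intro hz
  have n1 := hn z; have n2 := hn (T z); have n3 := hn (T (T z)); have n4 := hn (T (T (T z)))
  have h1 := hall z; have h2 := hall (T z); have h3 := hall (T (T z)); have h4 := hall (T (T (T z)))
  have i1 := @hT z (T (T z)); have i2 := @hT (T z) (T (T (T z)))
  have n1 := hn a; have n2 := hn b; have n3 := hn c
  have i1 := @hT a b; have i2 := @hT a c; have i3 := @hT b c
  have g1 := hall (T a); have g2 := hall (T b); have g3 := hall (T c)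
  grind

end comb

section core2
variable {G : Type*} [Group G]

/-- existence of a generating pair with an abelian normal subgroup containing the second entry -/
def Good (G : Type*) [Group G] : Prop := ∃ u v : G, Gen u v ∧
      ∃ A : Subgroup G, A.Normal ∧ v ∈ A ∧ ∀ a ∈ A, ∀ b ∈ A, Commute a b

theorem T_fix {x y : G} (h : Gen x y) (hT : cT (cls x y h) = cls x y h) :
    ∃ t, Commute t y ∧ t * x * t⁻¹ = x * y ∧ Gen x t := by
  rw [cT_cls, cls_eq] at hT
  obtain ⟨t, h1, h2⟩ := hT.symm
  refine ⟨t, comm_conj_iff.2 h2, h1, h.of_mem' fun K hx ht => ⟨hx, ?_⟩⟩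
  have : y = x⁻¹ * (t * x * t⁻¹) := by rw [h1]; group
  rw [this]
  exact K.mul_mem (K.inv_mem hx) (K.mul_mem (K.mul_mem ht hx) (K.inv_mem ht))

theorem R_fix (hZ : Subgroup.center G = ⊥) {c : Cls G} (hR : cR c = c) :
    ∃ x r : G, ∃ _ : Gen x r, r ^ 3 = 1 := by
  obtain ⟨x, y, h, rfl⟩ := cls_ind c
  rw [cR_cls, cls_eq] at hR
  obtain ⟨r, h1, h2⟩ := hR.symm
  refine ⟨x, r, h.of_mem' fun K hx hr => ⟨hx, ?_⟩, ?_⟩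
  · rw [← h1]; exact K.mul_mem (K.mul_mem hr hx) (K.inv_mem hr)
  · have e3 : r * (x * y)⁻¹ * r⁻¹ = x := by
      calc _ = ((r * x * r⁻¹) * (r * y * r⁻¹))⁻¹ := by group
        _ = x := by rw [h1, h2]; group
    refine h.eq_one hZ (comm_conj_iff.2 ?_) (comm_conj_iff.2 ?_)
    · calc _ = r * (r * (r * x * r⁻¹) * r⁻¹) * r⁻¹ := by
            simp only [pow_succ, pow_zero, one_mul]; group
        _ = _ := by rw [h1, h2, e3]
    · calc _ = r * (r * (r * y * r⁻¹) * r⁻¹) * r⁻¹ := by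
            simp only [pow_succ, pow_zero, one_mul]; group
        _ = _ := by rw [h2, e3, h1]

theorem S_fix (hZ : Subgroup.center G = ⊥) {c : Cls G} (hS : cS c = c) :
    ∃ x r : G, ∃ _ : Gen x r, r ^ 4 = 1 := by
  obtain ⟨x, y, h, rfl⟩ := cls_ind c
  rw [cS_cls, cls_eq] at hS
  obtain ⟨r, h1, h2⟩ := hS.symm
  refine ⟨x, r, h.of_mem' fun K hx hr => ⟨hx, ?_⟩, ?_⟩
  · rw [← inv_inv y, ← h1]
    exact K.inv_mem (K.mul_mem (K.mul_mem hr hx) (K.inv_mem hr))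
  · have e3 : r * y⁻¹ * r⁻¹ = x⁻¹ := by rw [← h2]; group
    have e4 : r * x⁻¹ * r⁻¹ = y := by rw [← inv_inv y, ← h1]; group
    refine h.eq_one hZ (comm_conj_iff.2 ?_) (comm_conj_iff.2 ?_)
    · calc _ = r * (r * (r * (r * x * r⁻¹) * r⁻¹) * r⁻¹) * r⁻¹ := by
            simp only [pow_succ, pow_zero, one_mul]; group
        _ = _ := by rw [h1, e3, e4, h2]
    · calc _ = r * (r * (r * (r * y * r⁻¹) * r⁻¹) * r⁻¹) * r⁻¹ := by
            simp only [pow_succ, pow_zero, one_mul]; group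
        _ = _ := by rw [h2, h1, e3, e4]

theorem T_three {x r : G} (h : Gen x r) (hr : r ^ 3 = 1) :
    cT (cT (cT (cls x r h))) = cls x r h := by
  rw [cT_cls, cT_cls, cT_cls]
  refine cls_congr _ _ ?_ rfl
  calc _ = x * r ^ 3 := by simp only [pow_succ, pow_zero, one_mul]; group
    _ = x := by rw [hr, mul_one]

theorem T_four {x r : G} (h : Gen x r) (hr : r ^ 4 = 1) :
    cT (cT (cT (cT (cls x r h)))) = cls x r h := by
  rw [cT_cls, cT_cls, cT_cls, cT_cls]
  refine cls_congr _ _ ?_ rfl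
  calc _ = x * r ^ 4 := by simp only [pow_succ, pow_zero, one_mul]; group
    _ = x := by rw [hr, mul_one]

theorem good_swap_conj {x y u v : G} (h : Sim x y u v) (n : ℕ) (hy : x ^ n = 1) : u ^ n = 1 := by
  obtain ⟨g, rfl, rfl⟩ := h
  rw [conj_pow, hy]; simp

theorem Sim.pi {x y u v : G} (h : Sim x y u v) (hy : Commute y (x⁻¹ * y * x)) :
    Commute v (u⁻¹ * v * u) := by
  obtain ⟨g, rfl, rfl⟩ := h
  have e : (g * x * g⁻¹)⁻¹ * (g * y * g⁻¹) * (g * x * g⁻¹) = g * (x⁻¹ * y * x) * g⁻¹ := by group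
  rw [e]
  exact (Commute.conj_iff g).2 hy

/-- class fixed by everything of exponent three -/
theorem good_burnside [Finite G] {x r : G} (h : Gen x r) (hr : r ^ 3 = 1)
    (hT : cT (cls x r h) = cls x r h) (hW : cW (cls x r h) = cls x r h) : Good G := by
  have hx : x ^ 3 = 1 := by
    rw [cW_cls, cls_eq] at hW
    exact good_swap_conj hW 3 hr
  have h1 : (x * r) ^ 3 = 1 := by
    rw [cT_cls, cls_eq] at hT
    exact good_swap_conj hT.symm 3 hx
  have h2 : (x * r⁻¹) ^ 3 = 1 := by
    rw [cT_cls, cls_eq] at hT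
    obtain ⟨g, e1, e2⟩ := hT
    have : g * x * g⁻¹ = x * r⁻¹ := by
      calc _ = (g * (x * r) * g⁻¹) * (g * r * g⁻¹)⁻¹ := by group
        _ = _ := by rw [e1, e2]
    rw [← this, conj_pow, hx]; simp
  -- a_i = r^-i x r^i
  have r2 : r ^ 2 = r⁻¹ := by rw [eq_inv_iff_mul_eq_one, ← pow_succ]; exact hr
  have rr : r * r = r⁻¹ := by rw [← pow_two]; exact r2
  have rr' : r⁻¹ * r⁻¹ = r := by rw [← mul_inv_rev, rr, inv_inv]
  set a1 := r⁻¹ * x * r with ha1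
  set a2 := r * x * r⁻¹ with ha2
  have p1 : x * a2 * a1 = 1 := by
    rw [← h1, ha1, ha2]
    calc _ = x * r * x * (r⁻¹ * r⁻¹) * x * r := by group
      _ = _ := by rw [rr']; simp only [pow_succ, pow_zero, one_mul]; group
  have p2 : x * a1 * a2 = 1 := by
    rw [← h2, ha1, ha2]
    calc _ = x * r⁻¹ * x * (r * r) * x * r⁻¹ := by group
      _ = _ := by rw [rr]; simp only [pow_succ, pow_zero, one_mul]; group
  have c01 : Commute x a1 := by
    have e1 : a2⁻¹ = x * a1 := inv_eq_of_mul_eq_one_left p2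
    have e2 : a2⁻¹ = a1 * x := by
      apply inv_eq_of_mul_eq_one_right
      calc _ = x⁻¹ * (x * a2 * a1) * x := by group
        _ = 1 := by rw [p1]; group
    exact e1.symm.trans e2
  have e2 : r⁻¹ ^ 2 * x * r ^ 2 = a2 := by
    rw [r2, ha2, pow_two, rr']
  refine ⟨r, x, h.swap, abelian_of_rec h.swap c01 ?_⟩
  rw [e2]
  -- a2 x = a1^2, with a1^3 = 1
  have a13 : a1 ^ 3 = 1 := by
    rw [ha1]
    have := conj_pow (i := 3) (a := r⁻¹) (b := x)
    rw [inv_inv] at this; rw [this, hx]; simp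
  have : a2 * x * a1 = 1 := by
    have e3 : a2 = (x * a1)⁻¹ := (inv_eq_of_mul_eq_one_right p2).symm
    calc _ = (x * a1)⁻¹ * (x * a1) := by rw [e3]; group
      _ = 1 := by group
  calc a2 * x = (a2 * x * a1) * a1⁻¹ := by group
    _ = a1 ^ 2 := by rw [this, one_mul, inv_eq_iff_mul_eq_one, ← pow_succ', a13]

end core2


section core3
variable {G : Type*} [Group G]

theorem pi_of_t {x y t : G} (ht : Commute t y) (hx : t * x * t⁻¹ = x * y) :
    Commute t (x⁻¹ * t * x) := by
  have : x⁻¹ * t * x = y * t := by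
    calc _ = x⁻¹ * (t * x * t⁻¹) * t := by group
      _ = _ := by rw [hx]; group
  rw [this]
  exact ht.mul_right (Commute.refl t)

/-- the odd-odd case -/
theorem good_odd (hZ : Subgroup.center G = ⊥) {x y t : G} (h : Gen x y)
    (ht : Commute t y) (hx : t * x * t⁻¹ = x * y) (hs : Sim x t t x)
    (hs2 : Sim x t x (t * x ^ 2)) : Good G := by
  have p1 := pi_of_t ht hx
  have p2 := hs2.pi p1
  have hy : y = x⁻¹ * t * x * t⁻¹ := by
    calc _ = x⁻¹ * (x * y) := by group
      _ = _ := by rw [← hx]; group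
  set u := x⁻¹ * t * x with hu
  have e1 : x⁻¹ * (t * x ^ 2) * x = u * x ^ 2 := by rw [hu, pow_two]; group
  rw [e1] at p2
  have e2 : t * x ^ 2 * u = u * x ^ 2 * t := by
    have := p2.eq
    calc _ = (t * x ^ 2 * (u * x ^ 2)) * (x ^ 2)⁻¹ := by group
      _ = _ := by rw [this]; group
  have c2 : Commute (x ^ 2) y := by
    -- y = u t⁻¹ = t⁻¹ u
    have hy' : y = t⁻¹ * u := by rw [hy]; exact (p1.inv_left.eq).symm
    show x ^ 2 * y = y * x ^ 2
    calc x ^ 2 * y = t⁻¹ * (t * x ^ 2 * u) * t⁻¹ := by rw [hy]; group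
      _ = t⁻¹ * u * x ^ 2 := by rw [e2]; group
      _ = _ := by rw [← hy']
  have x2 : x ^ 2 = 1 := h.eq_one hZ ((Commute.refl x).pow_left 2) c2
  have t2 : t ^ 2 = 1 := good_swap_conj hs 2 x2
  have xi : x⁻¹ = x := by rw [inv_eq_iff_mul_eq_one, ← pow_two, x2]
  have ti : t⁻¹ = t := by rw [inv_eq_iff_mul_eq_one, ← pow_two, t2]
  have hy2 : y = x * t * x * t := by rw [hy, hu, xi, ti]
  have yi : y⁻¹ = t * x * t * x := by rw [hy2]; simp only [mul_inv_rev, xi, ti, mul_assoc]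
  have tt : t * t = 1 := by rw [← pow_two, t2]
  have xx : x * x = 1 := by rw [← pow_two, x2]
  have ty : y = y⁻¹ := by
    have h1 := comm_conj_iff.1 ht
    rw [ti] at h1
    rw [yi]
    calc y = t * y * t := h1.symm
      _ = t * x * t * x * (t * t) := by rw [hy2]; group
      _ = _ := by rw [tt, mul_one]
  have xy : Commute x y := by
    rw [comm_conj_iff, xi]
    conv_rhs => rw [ty, yi]
    rw [hy2]
    calc _ = (x * x) * t * x * t * x := by group
      _ = _ := by rw [xx, one_mul]
  have y1 : y = 1 := h.eq_one hZ xy.symm (Commute.refl y)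
  refine ⟨x, y, h, ⊥, inferInstance, by simp [y1], ?_⟩
  intro a ha b hb
  rw [Subgroup.mem_bot] at ha hb
  rw [ha, hb]

/-- the even-odd case -/
theorem good_even [Finite G] {x y t : G} (h : Gen x y)
    (ht : Commute t y) (hx : t * x * t⁻¹ = x * y) (hs : Sim t x x y)
    (hs2 : Sim x y (x * y) y) : Good G := by
  have p1 := pi_of_t ht hx
  have q : Sim x t y x := by
    obtain ⟨g, h1, h2⟩ := hs
    exact ⟨g, h2, h1⟩
  have p2 := q.pi p1
  have q2 : Sim y x y (x * y) := by
    obtain ⟨g, h1, h2⟩ := hs2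
    exact ⟨g, h2, h1⟩
  have p3 := q2.pi p2
  refine ⟨y, x, h.swap, abelian_of_rec h.swap p2 ?_⟩
  have := p3.eq
  have e : y * x * x * y = x * y * y * x := by
    calc _ = y * ((x * y) * (y⁻¹ * (x * y) * y)) * y⁻¹ := by group
      _ = _ := by rw [this]; group
  calc _ = y⁻¹ * y⁻¹ * (x * y * y * x) := by simp only [pow_two]; group
    _ = _ := by rw [← e]; simp only [pow_two]; group

theorem core [Finite G] (hZ : Subgroup.center G = ⊥) (hX : Nat.card (Cls G) ≤ 3)
    {x₀ y₀ : G} (h₀ : Gen x₀ y₀) : Good G := by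
  have four := four_of_card hX
  have Rinj : ∀ c : Cls G, cR (cR (cR c)) = c := cR_three
  by_cases hfix : ∃ p : Cls G, cT p = p
  · by_cases hall : ∀ c : Cls G, cT c = c
    · exact iterate_abelian Gen (fun _ _ h => h) (fun x y h => T_fix h (hall _)) h₀
    · push Not at hall
      obtain ⟨q, hq⟩ := hall
      obtain ⟨p, hp⟩ := hfix
      have d1 : p ≠ q := by rintro rfl; exact hq hp
      have d2 : p ≠ cT q := fun e => d1 (cT_inj (hp.trans e))
      have cov : ∀ z, z = p ∨ z = q ∨ z = cT q := by
        intro z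
        have := four p q (cT q) z
        grind
      have tq : cT (cT q) = q := by
        rcases cov (cT (cT q)) with e | e | e
        · exact absurd (cT_inj (hp.trans e.symm)) d2
        · exact e
        · exact absurd (cT_inj e) hq
      have T2 : ∀ z : Cls G, cT (cT z) = z := by
        intro z
        rcases cov z with rfl | rfl | rfl
        · rw [hp, hp]
        · exact tq
        · rw [tq]
      have fx : ∀ z : Cls G, cT z = z → z = p := by
        intro z hz
        rcases cov z with rfl | rfl | rfl
        · rfl
        · exact absurd hz hq
        · exact absurd (cT_inj hz) hq
      by_cases hW : cW p = p
      · have hE : cE p = p := by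
          apply fx
          conv_lhs => rw [← hp]
          exact cT_cE_cT p
        have hR : cR p = p := by unfold cR; rw [hp, hW, hE]
        obtain ⟨x, r, h, hr⟩ := R_fix hZ hR
        have h3 := T_three h hr
        rw [T2] at h3
        have e := fx _ h3
        exact good_burnside h hr h3 (by rw [e, hW])
      · by_cases H : ∀ (x y t : G) (h : Gen x y) (k : Gen x t), cls x y h = p → Commute t y →
            t * x * t⁻¹ = x * y → cls x t k = p
        · obtain ⟨x, y, h, e⟩ := cls_ind p
          refine iterate_abelian (fun x y => ∃ h : Gen x y, cls x y h = p) (fun _ _ h => h.1)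
            ?_ ⟨h, e.symm⟩
          rintro x y ⟨h, e⟩
          obtain ⟨t, h1, h2, h3⟩ := T_fix h (by rw [e, hp])
          exact ⟨t, h1, h2, h3, H x y t h h3 e h1 h2⟩
        · push Not at H
          obtain ⟨x, y, t, h, k, e, h1, h2, h3⟩ := H
          by_cases hη : cls x t k = cW p
          · have : cls t x k.swap = cls x y h := by
              rw [← cW_cls k, hη, cW_cW, e]
            rw [← e, cT_cls, cls_eq] at hp
            exact good_even h h1 h2 (cls_eq.1 this) hp.symm
          · have hw : cW (cls x t k) = cls x t k := by
              have f := four p (cW p) (cls x t k) (cW (cls x t k))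
              have g1 : p ≠ cW (cls x t k) := by
                intro e; exact hη (by rw [e, cW_cW])
              have g2 : cW p ≠ cW (cls x t k) := by
                intro e
                have := congrArg cW e
                rw [cW_cW, cW_cW] at this
                exact h3 this.symm
              grind
            have hw2 : cls x t k = cW (cT (cT (cW (cls x t k)))) := by
              rw [T2, cW_cW]
            rw [cW_cls, cT_cls, cT_cls, cW_cls, cls_eq] at hw2
            rw [cW_cls, cls_eq] at hw
            refine good_odd hZ h h1 h2 hw.symm ?_
            rwa [pow_two, ← mul_assoc]
  · exfalso
    push Not at hfix
    obtain ⟨a, b, c, hab, hac, hbc⟩ : ∃ a b c : Cls G, a ≠ b ∧ a ≠ c ∧ b ≠ c := by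
      by_cases hR : cR (cls x₀ y₀ h₀) = cls x₀ y₀ h₀
      · obtain ⟨x, r, h, hr⟩ := R_fix hZ hR
        have h3 := T_three h hr
        refine ⟨_, cT (cls x r h), cT (cT (cls x r h)), (hfix _).symm, ?_, (hfix _).symm⟩
        intro e
        rw [← e] at h3
        exact hfix _ h3
      · have h3 := cR_three (cls x₀ y₀ h₀)
        refine ⟨_, cR (cls x₀ y₀ h₀), cR (cR (cls x₀ y₀ h₀)), Ne.symm hR, ?_, ?_⟩
        · intro e
          rw [← e] at h3
          exact hR h3
        · intro e
          rw [← e, ← e] at h3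
          exact hR h3
    have cov : ∀ z, z = a ∨ z = b ∨ z = c := by
      intro z
      have := four a b c z
      grind
    obtain ⟨z, hz⟩ := fix_of_four hab hac hbc cov cS cS_four
    obtain ⟨x, r, h, hr⟩ := S_fix hZ hz
    exact nofix_four hab hac hbc cov cT cT_inj hfix _ (T_four h hr)

end core3

set_option linter.unusedSimpArgs false

section structureD
variable {G : Type*} [Group G]

theorem structD [Finite G] [Nontrivial G] (hZ : Subgroup.center G = ⊥)
    (hX : Nat.card (Cls G) ≤ 3) (hG : Good G) :
    ∃ x y : G, Gen x y ∧ x ^ 2 = 1 ∧ y ^ 3 = 1 ∧ x * y * x⁻¹ = y⁻¹ ∧ x ≠ 1 ∧ y ≠ 1 ∧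
      ∃ A : Subgroup G, A ≠ ⊤ ∧ ∀ g : G, g ^ 2 ∈ A := by
  obtain ⟨x, y, h, A, hA, hyA, hab⟩ := hG
  have four := four_of_card hX
  have hntop : A ≠ ⊤ := by
    rintro rfl
    have : Subgroup.center G = ⊤ := by
      rw [Subgroup.eq_top_iff']
      intro z
      rw [Subgroup.mem_center_iff]
      intro g
      exact hab g trivial z trivial
    rw [hZ] at this
    exact bot_ne_top this
  have hxA : x ∉ A := fun hx => hntop (h.eq_top A hx hyA)
  let π := QuotientGroup.mk' A
  have πA : ∀ g, π g = 1 ↔ g ∈ A := fun g => QuotientGroup.eq_one_iff g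
  have πy : π y = 1 := (πA y).2 hyA
  have πx : π x ≠ 1 := fun e => hxA ((πA x).1 e)
  have c1 : ∀ g, Commute (π x) (π g) := by
    intro g
    have := h.eq_top ((Subgroup.centralizer {π x}).comap π)
      (by simp [Subgroup.mem_centralizer_singleton_iff])
      (by rw [Subgroup.mem_comap, Subgroup.mem_centralizer_singleton_iff, πy]; simp)
    have hg : g ∈ ((Subgroup.centralizer {π x}).comap π) := by rw [this]; trivial
    rw [Subgroup.mem_comap, Subgroup.mem_centralizer_singleton_iff] at hg
    exact hg.symm
  have c2 : ∀ g k, Commute (π g) (π k) := by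
    intro g k
    have := h.eq_top ((Subgroup.centralizer {π g}).comap π)
      (by rw [Subgroup.mem_comap, Subgroup.mem_centralizer_singleton_iff]; exact c1 g)
      (by rw [Subgroup.mem_comap, Subgroup.mem_centralizer_singleton_iff, πy]; simp)
    have hg : k ∈ ((Subgroup.centralizer {π g}).comap π) := by rw [this]; trivial
    rw [Subgroup.mem_comap, Subgroup.mem_centralizer_singleton_iff] at hg
    exact hg.symm
  have lab : ∀ {a b u v : G} {k : Gen a b} {l : Gen u v}, cls a b k = cls u v l →
      π a = π u ∧ π b = π v := by
    intro a b u v k l e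
    obtain ⟨g, rfl, rfl⟩ := cls_eq.1 e
    simp only [map_mul, map_inv]
    exact ⟨(comm_conj_iff.1 (c2 g a)).symm, (comm_conj_iff.1 (c2 g b)).symm⟩
  have g1 : Gen x (x * y) := h.of_mem' fun K h1 h2 =>
    ⟨h1, by simpa using K.mul_mem (K.inv_mem h1) h2⟩
  have g2 : Gen x (x * (x * y)) := g1.of_mem' fun K h1 h2 =>
    ⟨h1, by simpa using K.mul_mem (K.inv_mem h1) h2⟩
  have πx2 : π x * π x = 1 := by
    by_contra hne
    rcases four (cls x y h) (cls y x h.swap) (cls x _ g1) (cls x _ g2) with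
      e | e | e | e | e | e
    all_goals
      have hl := lab e
      simp only [map_mul, πy, mul_one] at hl
      clear c1 c2 πA lab four
      generalize π x = X at *
      have hi : X = X * X → X = 1 := fun e => left_eq_mul.1 e
      grind
  have x2 : x ^ 2 = 1 := by
    have : x ^ 2 ∈ A := by rw [← πA, pow_two, map_mul, πx2]
    exact h.eq_one hZ ((Commute.refl x).pow_left 2) (hab _ this _ hyA)
  have xi : x⁻¹ = x := by rw [inv_eq_iff_mul_eq_one, ← pow_two, x2]
  have xx : x * x = 1 := by rw [← pow_two, x2]
  have hyx : x * y * x⁻¹ ∈ A := hA.conj_mem y hyA x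
  have hinv : x * y * x⁻¹ = y⁻¹ := by
    have cc := hab _ hyA _ hyx
    have : y * (x * y * x⁻¹) = 1 := by
      refine h.eq_one hZ ?_ (hab _ (A.mul_mem hyA hyx) _ hyA)
      symm
      rw [comm_conj_iff]
      calc _ = (x * y * x⁻¹) * (x * x * y * (x * x)⁻¹) := by group
        _ = _ := by rw [xx, inv_one, one_mul, mul_one]; exact cc.eq.symm
    exact (inv_eq_of_mul_eq_one_right this).symm
  have y1 : y ≠ 1 := by
    intro e
    have : x = 1 := h.eq_one hZ (Commute.refl x) (by rw [e]; exact Commute.one_right x)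
    exact hxA (this ▸ A.one_mem)
  have hinvn : ∀ n : ℕ, x * y ^ n * x⁻¹ = (y ^ n)⁻¹ := by
    intro n
    rw [← conj_pow, hinv, inv_pow]
  have hodd : Odd (orderOf y) := by
    by_contra hev
    rw [Nat.not_odd_iff_even] at hev
    obtain ⟨n, hn⟩ := hev
    have hpos := orderOf_pos y
    have e1 : y ^ n * y ^ n = 1 := by rw [← pow_add, ← hn, pow_orderOf_eq_one]
    have : y ^ n = 1 := by
      refine h.eq_one hZ ?_ ((Commute.refl y).pow_left n)
      symm
      rw [comm_conj_iff, hinvn]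
      exact inv_eq_of_mul_eq_one_left e1
    have := Nat.le_of_dvd (by omega) (orderOf_dvd_of_pow_eq_one this)
    omega
  have g3 : Gen x (y ^ 2) := h.of_mem' fun K h1 h2 => ⟨h1, by
    obtain ⟨n, hn⟩ := hodd
    have : y = (y ^ 2) ^ (n + 1) := by
      rw [← pow_mul, show 2 * (n + 1) = orderOf y + 1 by omega, pow_succ, pow_orderOf_eq_one,
        one_mul]
    rw [this]; exact K.pow_mem h2 _⟩
  have hs : Sim x y x (y ^ 2) := by
    rcases four (cls x y h) (cls y x h.swap) (cls x _ g1) (cls x _ g3) with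
      e | e | e | e | e | e
    · have hl := lab e
      simp only [map_mul, map_pow, πy, mul_one, one_pow] at hl
      clear c1 c2 πA lab four
      generalize π x = X at *
      grind
    · have hl := lab e
      simp only [map_mul, map_pow, πy, mul_one, one_pow] at hl
      clear c1 c2 πA lab four
      generalize π x = X at *
      grind
    · exact cls_eq.1 e
    · have hl := lab e
      simp only [map_mul, map_pow, πy, mul_one, one_pow] at hl
      clear c1 c2 πA lab four
      generalize π x = X at *
      grind
    · have hl := lab e
      simp only [map_mul, map_pow, πy, mul_one, one_pow] at hl
      clear c1 c2 πA lab four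
      generalize π x = X at *
      grind
    · have hl := lab e
      simp only [map_mul, map_pow, πy, mul_one, one_pow] at hl
      clear c1 c2 πA lab four
      generalize π x = X at *
      grind
  obtain ⟨g, -, hg⟩ := hs
  have pm : ∀ g : G, g * y * g⁻¹ = y ∨ g * y * g⁻¹ = y⁻¹ := by
    let K : Subgroup G :=
      { carrier := {g | g * y * g⁻¹ = y ∨ g * y * g⁻¹ = y⁻¹}
        one_mem' := by simp
        mul_mem' := by
          intro a b ha hb
          have e : a * b * y * (a * b)⁻¹ = a * (b * y * b⁻¹) * a⁻¹ := by group
          have e2 : a * y⁻¹ * a⁻¹ = (a * y * a⁻¹)⁻¹ := by group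
          simp only [Set.mem_ofPred_eq] at ha hb ⊢
          rw [e]
          rcases hb with hb | hb <;> rw [hb]
          · exact ha
          · rw [e2]
            rcases ha with ha | ha <;> rw [ha] <;> simp
        inv_mem' := by
          intro a ha
          simp only [Set.mem_ofPred_eq] at ha ⊢
          rcases ha with ha | ha
          · left
            conv_lhs => rw [← ha]
            group
          · right
            have : y = (a * y * a⁻¹)⁻¹ := by rw [ha, inv_inv]
            conv_lhs => rw [this]
            group }
    have := h.eq_top K (Or.inr hinv) (Or.inl (by simp))
    intro g
    have hg : g ∈ K := by rw [this]; trivial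
    exact hg
  have y3 : y ^ 3 = 1 := by
    rcases pm g with e | e
    · rw [hg] at e
      rw [pow_two] at e
      exact absurd (mul_eq_right.1 e) y1
    · rw [hg] at e
      rw [pow_succ, e]; simp
  refine ⟨x, y, h, x2, y3, hinv, fun e => hxA (e ▸ A.one_mem), y1, A, hntop, ?_⟩
  let K : Subgroup G :=
    { carrier := {g | π g ^ 2 = 1}
      one_mem' := by simp
      mul_mem' := by
        intro a b ha hb
        simp only [Set.mem_ofPred_eq] at ha hb ⊢
        rw [map_mul, (c2 a b).mul_pow, ha, hb, one_mul]
      inv_mem' := by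
        intro a ha
        simp only [Set.mem_ofPred_eq] at ha ⊢
        rw [map_inv, inv_pow, ha, inv_one] }
  have := h.eq_top K (show π x ^ 2 = 1 by rw [pow_two, πx2]) (show π y ^ 2 = 1 by simp [πy])
  intro g
  have hg : g ∈ K := by rw [this]; trivial
  rw [← πA, map_pow]
  exact hg

end structureD


section vier
variable {G : Type*} [Group G]

/-- The Klein four group. -/
abbrev V4 := Multiplicative (ZMod 2 × ZMod 2)

theorem V4_sq (u : V4) : u * u = 1 := by revert u; decide

theorem V4_four : ∀ u v z : V4, u ≠ 1 → v ≠ 1 → u ≠ v → z = 1 ∨ z = u ∨ z = v ∨ z = u * v := by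
  decide

theorem V4_third : ∀ w : V4, ∃ z : V4, z ≠ 1 ∧ z ≠ w := by decide

theorem V4_noncyc (w : V4) {u v : V4} (h : Gen u v) (hu : u = 1 ∨ u = w) (hv : v = 1 ∨ v = w) :
    False := by
  let K : Subgroup V4 :=
    { carrier := {z | z = 1 ∨ z = w}
      one_mem' := Or.inl rfl
      mul_mem' := by
        rintro a b (rfl | rfl) (rfl | rfl)
        · simp
        · simp
        · simp
        · left; exact V4_sq _
      inv_mem' := by
        rintro a (rfl | rfl)
        · simp
        · right; exact inv_eq_of_mul_eq_one_right (V4_sq _) }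
  have := h.eq_top K hu hv
  obtain ⟨z, h1, h2⟩ := V4_third w
  have hz : z ∈ K := by rw [this]; trivial
  rcases hz with hz | hz
  · exact h1 hz
  · exact h2 hz

theorem V4_gen_iff (u v : V4) : Gen u v ↔ u ≠ 1 ∧ v ≠ 1 ∧ u ≠ v := by
  constructor
  · intro h
    exact ⟨fun e => V4_noncyc v h (Or.inl e) (Or.inr rfl),
      fun e => V4_noncyc u h (Or.inr rfl) (Or.inl e),
      fun e => V4_noncyc u h (Or.inr rfl) (Or.inr e.symm)⟩
  · rintro ⟨h1, h2, h3⟩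
    unfold Gen
    rw [Subgroup.eq_top_iff']
    intro z
    rcases V4_four u v z h1 h2 h3 with rfl | rfl | rfl | rfl
    · exact Subgroup.one_mem _
    · exact mem_cl_left _ _
    · exact mem_cl_right _ _
    · exact Subgroup.mul_mem _ (mem_cl_left _ _) (mem_cl_right _ _)

/-- generating labels -/
abbrev Lab := {p : V4 × V4 // p.1 ≠ 1 ∧ p.2 ≠ 1 ∧ p.1 ≠ p.2}

theorem card_Lab : Nat.card Lab = 6 := by
  rw [Nat.card_eq_fintype_card]; decide

theorem exists_exp {a b : G} (h : Gen a b) (g : G) : ∃ i j : ℤ,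
    Abelianization.of g = Abelianization.of a ^ i * Abelianization.of b ^ j := by
  have hg : g ∈ Subgroup.closure ({a, b} : Set G) := by rw [h]; trivial
  induction hg using Subgroup.closure_induction with
  | mem x hx =>
    rcases hx with rfl | rfl
    · exact ⟨1, 0, by simp⟩
    · exact ⟨0, 1, by simp⟩
  | one => exact ⟨0, 0, by simp⟩
  | mul x y _ _ hx hy =>
    obtain ⟨i, j, h1⟩ := hx
    obtain ⟨k, l, h2⟩ := hy
    refine ⟨i + k, j + l, ?_⟩
    rw [map_mul, h1, h2, zpow_add, zpow_add]
    exact mul_mul_mul_comm _ _ _ _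
  | inv x _ hx =>
    obtain ⟨i, j, h1⟩ := hx
    refine ⟨-i, -j, ?_⟩
    rw [map_inv, h1, mul_inv, zpow_neg, zpow_neg]

theorem exp_apply {a b g : G} {i j : ℤ}
    (h : Abelianization.of g = Abelianization.of a ^ i * Abelianization.of b ^ j)
    {A : Type*} [CommGroup A] (ψ : G →* A) : ψ g = ψ a ^ i * ψ b ^ j := by
  have := congrArg (Abelianization.lift ψ) h
  simpa using this

theorem zpow_of_sq {A : Type*} [Group A] {u : A} (hu : u * u = 1) (i : ℤ) :
    (Even i → u ^ i = 1) ∧ (Odd i → u ^ i = u) := by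
  constructor
  · rintro ⟨k, rfl⟩
    rw [zpow_add, ← (Commute.refl u).mul_zpow, hu, one_zpow]
  · rintro ⟨k, rfl⟩
    rw [zpow_add, two_mul, zpow_add, ← (Commute.refl u).mul_zpow, hu, one_zpow, one_mul, zpow_one]

theorem V4_even {u v : V4} (h : Gen u v) {i j : ℤ} (e : u ^ i * v ^ j = 1) :
    Even i ∧ Even j := by
  obtain ⟨h1, h2, h3⟩ := (V4_gen_iff u v).1 h
  have hi := zpow_of_sq (V4_sq u) i
  have hj := zpow_of_sq (V4_sq v) j
  rcases Int.even_or_odd i with a | a <;> rcases Int.even_or_odd j with b | b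
  · exact ⟨a, b⟩
  · rw [hi.1 a, hj.2 b, one_mul] at e; exact absurd e h2
  · rw [hi.2 a, hj.1 b, mul_one] at e; exact absurd e h1
  · rw [hi.2 a, hj.2 b] at e
    exact absurd (mul_right_cancel (e.trans (V4_sq v).symm)) h3

theorem ker_le {a b : G} (h : Gen a b) (f : G →* V4) (hf : Function.Surjective f)
    (H : Subgroup G) (hH : ∀ g : G, g * g ∈ H) : f.ker ≤ H := by
  have hN : H.Normal := by
    constructor
    intro n hn g
    have e : g * n * g⁻¹ = (g * g) * ((g⁻¹ * n) * (g⁻¹ * n)) * (n * n)⁻¹ * n := by group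
    rw [e]
    exact H.mul_mem (H.mul_mem (H.mul_mem (hH _) (hH _)) (H.inv_mem (hH _))) hn
  have hq : ∀ q : G ⧸ H, q * q = 1 := by
    intro q
    induction q using QuotientGroup.induction_on with
    | H z =>
      rw [← QuotientGroup.mk_mul]
      exact (QuotientGroup.eq_one_iff _).2 (hH z)
  let _ : CommGroup (G ⧸ H) :=
    { (inferInstance : Group (G ⧸ H)) with
      mul_comm := fun p q => by
        have := hq (p * q)
        have e : q * p = p * ((p * q) * (p * q)) * q := by
          calc q * p = (p * p) * (q * p) * (q * q) := by rw [hq, hq]; simp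
            _ = _ := by simp only [mul_assoc]
        rw [e, this, mul_one] }
  intro g hg
  obtain ⟨i, j, hij⟩ := exists_exp h g
  have h1 := exp_apply hij f
  rw [MonoidHom.mem_ker.1 hg] at h1
  obtain ⟨hi, hj⟩ := V4_even (h.map f hf) h1.symm
  have h2 := exp_apply hij (QuotientGroup.mk' H)
  rw [(zpow_of_sq (hq _) i).1 hi, (zpow_of_sq (hq _) j).1 hj, mul_one] at h2
  exact (QuotientGroup.eq_one_iff g).1 h2

theorem lab_surj {a b : G} (h : Gen a b) (f : G →* V4) (hf : Function.Surjective f) (s t : V4)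
    (hs : s ≠ 1) (ht : t ≠ 1) (hst : s ≠ t) : ∃ x y : G, Gen x y ∧ f x = s ∧ f y = t := by
  obtain ⟨h1, h2, h3⟩ := (V4_gen_iff _ _).1 (h.map f hf)
  have hs' := V4_four _ _ s h1 h2 h3
  have ht' := V4_four _ _ t h1 h2 h3
  have g1 : Gen a (a * b) := h.of_mem' fun K h1 h2 =>
    ⟨h1, by simpa using K.mul_mem (K.inv_mem h1) h2⟩
  have g2 := h.mulRight
  rcases hs' with e | e | e | e <;> rcases ht' with k | k | k | k
  all_goals first
    | exact absurd e hs
    | exact absurd k ht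
    | exact absurd (e.trans k.symm) hst
    | exact ⟨_, _, h, e.symm, k.symm⟩
    | exact ⟨_, _, h.swap, e.symm, k.symm⟩
    | exact ⟨_, _, g1, e.symm, by rw [map_mul, k]⟩
    | exact ⟨_, _, g1.swap, by rw [map_mul, e], k.symm⟩
    | exact ⟨_, _, g2, by rw [map_mul, e], k.symm⟩
    | exact ⟨_, _, g2.swap, e.symm, by rw [map_mul, k]⟩

theorem six_le_cls [Finite G] {a b : G} (h : Gen a b) (f : G →* V4)
    (hf : Function.Surjective f) : 6 ≤ Nat.card (Cls G) := by
  have key : ∀ p : Lab, ∃ c : Cls G, ∃ x y, ∃ k : Gen x y, c = cls x y k ∧ f x = p.1.1 ∧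
      f y = p.1.2 := by
    intro p
    obtain ⟨x, y, k, e1, e2⟩ := lab_surj h f hf p.1.1 p.1.2 p.2.1 p.2.2.1 p.2.2.2
    exact ⟨_, x, y, k, rfl, e1, e2⟩
  choose F hF using key
  rw [← card_Lab]
  refine Nat.card_le_card_of_injective F ?_
  intro p q e
  obtain ⟨x, y, k, e1, e2, e3⟩ := hF p
  obtain ⟨u, v, l, d1, d2, d3⟩ := hF q
  rw [e1, d1, cls_eq] at e
  obtain ⟨g, r1, r2⟩ := e
  have s1 := congrArg f r1
  have s2 := congrArg f r2
  simp only [map_mul, map_inv, mul_inv_cancel_comm] at s1 s2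
  ext1
  exact Prod.ext (by rw [← e2, ← d2, s1]) (by rw [← e3, ← d3, s2])

theorem cls_of_C2 [Finite G] {a b : G} (h : Gen a b) (χ : G →* Multiplicative (ZMod 2))
    (hχ : χ ≠ 1) : 3 ≤ Nat.card (Cls G) ∧ (Nat.card (Cls G) < 6 → Nat.card (Cls G) ≤ 3) := by
  classical
  have : Fintype (Cls G) := Fintype.ofFinite _
  have : Fact (Nat.Prime 3) := ⟨Nat.prime_three⟩
  have sq : ∀ z : Multiplicative (ZMod 2), z * z = 1 := by decide
  let R : Function.End (Cls G) := cR
  have hR : R ^ 3 ^ 1 = 1 := by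
    funext c
    exact cR_three c
  have hmod := Equiv.Perm.card_fixedPoints_modEq hR
  have hfix : IsEmpty (Function.fixedPoints (cR : Cls G → Cls G)) := by
    constructor
    rintro ⟨c, hc⟩
    obtain ⟨x, y, k, rfl⟩ := cls_ind c
    have hc' : cR (cls x y k) = cls x y k := hc
    rw [cR_cls, cls_eq] at hc'
    obtain ⟨g, r1, r2⟩ := hc'
    have s1 := congrArg χ r1
    have s2 := congrArg χ r2
    simp only [map_mul, map_inv, mul_inv_cancel_comm] at s1 s2
    have y1 : χ y = 1 := by rw [← s2, s1, sq]; simp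
    have x1 : χ x = 1 := by rw [← s1, y1]
    apply hχ
    have := k.eq_top χ.ker x1 y1
    rwa [MonoidHom.ker_eq_top_iff] at this
  have : Fintype.card (Function.fixedPoints (cR : Cls G → Cls G)) = 0 := Fintype.card_eq_zero
  have hmod' : Fintype.card (Cls G) ≡ 0 [MOD 3] := by rw [← this]; exact hmod
  have hpos : 0 < Fintype.card (Cls G) := Fintype.card_pos_iff.2 ⟨cls a b h⟩
  rw [Nat.card_eq_fintype_card]
  have := (Nat.modEq_zero_iff_dvd).1 hmod'
  omega

end vier


section lifting
open scoped IsMulCommutative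
variable {G : Type*} [Group G] {B : Type*} [Group B]

/-- retractions onto the central kernel of `π` -/
def Ret (π : G →* B) := {ψ : G →* Subgroup.center G // (∀ g, (ψ g : G) ∈ π.ker) ∧
  ∀ n ∈ π.ker, (ψ n : G) = n}

instance [Finite G] (π : G →* B) : Finite (Ret π) := by
  have : Function.Injective (fun ψ : Ret π => (fun g => ψ.1 g : G → Subgroup.center G)) := by
    intro ψ χ e
    exact Subtype.ext (MonoidHom.ext fun g => congrFun e g)
  exact Finite.of_injective _ this

theorem prime_ker_dich {N : Subgroup G} (hp : (Nat.card N).Prime) (H : Subgroup G) :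
    N ≤ H ∨ ∀ n ∈ N, n ∈ H → n = 1 := by
  have : Fact (Nat.card N).Prime := ⟨hp⟩
  rcases (H.subgroupOf N).eq_bot_or_eq_top_of_prime_card with h | h
  · right
    intro n hn hH
    have : (⟨n, hn⟩ : N) ∈ H.subgroupOf N := hH
    rw [h, Subgroup.mem_bot] at this
    exact congrArg Subtype.val this
  · left
    rwa [Subgroup.subgroupOf_eq_top] at h

theorem exists_ret (π : G →* B) (hc : π.ker ≤ Subgroup.center G)
    (hp : (Nat.card π.ker).Prime) {u v : G} (hg : Gen (π u) (π v)) (hn : ¬ Gen u v) :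
    ∃ ψ : Ret π, ψ.1 u = 1 ∧ ψ.1 v = 1 := by
  set H := Subgroup.closure ({u, v} : Set G) with hH
  have hmap : H.map π = ⊤ := hg.eq_top _ ⟨u, mem_cl_left _ _, rfl⟩ ⟨v, mem_cl_right _ _, rfl⟩
  have hlift : ∀ g, ∃ n : G, n ∈ π.ker ∧ g * n⁻¹ ∈ H := by
    intro g
    have : π g ∈ H.map π := by rw [hmap]; trivial
    obtain ⟨h, hh, e⟩ := this
    refine ⟨h⁻¹ * g, ?_, ?_⟩
    · rw [MonoidHom.mem_ker, map_mul, map_inv, e, inv_mul_cancel]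
    · have : g * (h⁻¹ * g)⁻¹ = h := by group
      rwa [this]
  have h_inter : ∀ n ∈ π.ker, n ∈ H → n = 1 := by
    rcases prime_ker_dich hp H with h | h
    · exfalso
      apply hn
      change H = ⊤
      rw [Subgroup.eq_top_iff']
      intro g
      obtain ⟨n, h1, h2⟩ := hlift g
      have := H.mul_mem h2 (h h1)
      simpa using this
    · exact h
  have huniq : ∀ g n m, n ∈ π.ker → m ∈ π.ker → g * n⁻¹ ∈ H → g * m⁻¹ ∈ H → n = m := by
    intro g n m h1 h2 h3 h4
    have : n * m⁻¹ = 1 := by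
      apply h_inter _ (π.ker.mul_mem h1 (π.ker.inv_mem h2))
      have := H.mul_mem (H.inv_mem h3) h4
      have e : (g * n⁻¹)⁻¹ * (g * m⁻¹) = n * m⁻¹ := by group
      rwa [e] at this
    exact mul_inv_eq_one.1 this
  choose r hr1 hr2 using hlift
  let ψ : G →* Subgroup.center G := MonoidHom.mk' (fun g => ⟨r g, hc (hr1 g)⟩) (by
    intro g k
    ext1
    apply huniq (g * k) _ _ (hr1 _) (π.ker.mul_mem (hr1 g) (hr1 k)) (hr2 _)
    have hz := Subgroup.mem_center_iff.1 (hc (π.ker.inv_mem (hr1 g)))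
    have e : g * k * (r g * r k)⁻¹ = (g * (r g)⁻¹) * (k * (r k)⁻¹) := by
      rw [mul_inv_rev]
      calc g * k * ((r k)⁻¹ * (r g)⁻¹) = g * ((k * (r k)⁻¹) * (r g)⁻¹) := by group
        _ = _ := by rw [hz]; group
    change g * k * (r g * r k)⁻¹ ∈ H
    rw [e]
    exact H.mul_mem (hr2 g) (hr2 k))
  have h1 : ∀ g, g ∈ H → ψ g = 1 := by
    intro g hg
    ext1
    exact huniq g (r g) 1 (hr1 g) (π.ker.one_mem) (hr2 g) (by simpa using hg)
  refine ⟨⟨ψ, fun g => hr1 g, fun n hn => ?_⟩, h1 u (mem_cl_left _ _), h1 v (mem_cl_right _ _)⟩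
  exact huniq n (r n) n (hr1 n) hn (hr2 n) (by simp)

theorem lift_count [Finite G] [Finite B] (π : G →* B) (hπ : Function.Surjective π)
    (hc : π.ker ≤ Subgroup.center G) (hp : (Nat.card π.ker).Prime) :
    Nat.card (Pairs B) * (Nat.card π.ker * Nat.card π.ker) ≤
      Nat.card (Pairs G) + Nat.card (Pairs B) * Nat.card (Ret π) := by
  classical
  obtain ⟨s, hs⟩ := hπ.hasRightInverse
  rw [← Nat.card_prod, ← Nat.card_prod, ← Nat.card_prod, ← Nat.card_sum]
  have hk : ∀ (q : B) (n : π.ker), π (s q * n) = q := by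
    intro q n
    rw [map_mul, hs, MonoidHom.mem_ker.1 n.2, mul_one]
  have hr : ∀ t : Pairs B × π.ker × π.ker, ¬ Gen (s t.1.1.1 * t.2.1) (s t.1.1.2 * t.2.2) →
      ∃ ψ : Ret π, ψ.1 (s t.1.1.1 * t.2.1) = 1 ∧ ψ.1 (s t.1.1.2 * t.2.2) = 1 := by
    intro t ht
    exact exists_ret π hc hp (by rw [hk, hk]; exact t.1.2) ht
  choose R hR1 hR2 using hr
  let F : Pairs B × π.ker × π.ker → Pairs G ⊕ (Pairs B × Ret π) := fun t =>
    if h : Gen (s t.1.1.1 * t.2.1) (s t.1.1.2 * t.2.2) then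
      Sum.inl ⟨(s t.1.1.1 * t.2.1, s t.1.1.2 * t.2.2), h⟩ else Sum.inr (t.1, R t h)
  refine Nat.card_le_card_of_injective F ?_
  rintro ⟨⟨⟨q1, q2⟩, hq⟩, n, m⟩ ⟨⟨⟨q1', q2'⟩, hq'⟩, n', m'⟩ e
  simp only [F] at e
  split_ifs at e with h1 h2 h2
  · have e1 : s q1 * n = s q1' * n' :=
      congrArg (fun t : Pairs G => t.1.1) (Sum.inl.inj e)
    have e2 : s q2 * m = s q2' * m' :=
      congrArg (fun t : Pairs G => t.1.2) (Sum.inl.inj e)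
    have a1 := congrArg π e1
    have a2 := congrArg π e2
    rw [hk, hk] at a1 a2
    subst a1; subst a2
    have b1 := Subtype.ext (mul_left_cancel e1)
    have b2 := Subtype.ext (mul_left_cancel e2)
    rw [b1, b2]
  · have e0 := Sum.inr.inj e
    have e1 : q1 = q1' := congrArg (fun t : Pairs B × Ret π => t.1.1.1) e0
    have e2 : q2 = q2' := congrArg (fun t : Pairs B × Ret π => t.1.1.2) e0
    have e3 := congrArg (fun t : Pairs B × Ret π => t.2) e0
    subst e1; subst e2
    have x1 := hR1 ⟨⟨(q1, q2), hq⟩, n, m⟩ h1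
    have x2 := hR2 ⟨⟨(q1, q2), hq⟩, n, m⟩ h1
    have y1 := hR1 ⟨⟨(q1, q2), hq'⟩, n', m'⟩ h2
    have y2 := hR2 ⟨⟨(q1, q2), hq'⟩, n', m'⟩ h2
    simp only at e3
    rw [← e3] at y1 y2
    obtain ⟨ψ, hψ⟩ : ∃ ψ, ψ = R ⟨⟨(q1, q2), hq⟩, n, m⟩ h1 := ⟨_, rfl⟩
    rw [← hψ] at x1 x2 y1 y2
    simp only at x1 x2 y1 y2
    clear hψ e3 e0 e
    have key : ∀ (q : G) (n n' : π.ker), ψ.1 (q * n) = 1 → ψ.1 (q * n') = 1 → n = n' := by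
      intro q n n' h h'
      rw [map_mul] at h h'
      have := mul_left_cancel (h.trans h'.symm)
      have := congrArg Subtype.val this
      rw [ψ.2.2 n n.2, ψ.2.2 n' n'.2] at this
      exact Subtype.ext this
    rw [key _ _ _ x1 y1, key _ _ _ x2 y2]

theorem card_ret_aux [Finite G] {a b : G} (h : Gen a b) (π : G →* B)
    (hp : (Nat.card π.ker).Prime) {c : G} {i j : ℤ} (hc : c ∈ π.ker)
    (e : Abelianization.of c = Abelianization.of a ^ i * Abelianization.of b ^ j)
    (hi : ¬ (Nat.card π.ker : ℤ) ∣ i) : Nat.card (Ret π) ≤ Nat.card π.ker := by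
  refine Nat.card_le_card_of_injective (fun ψ : Ret π => (⟨ψ.1 b, ψ.2.1 b⟩ : π.ker)) ?_
  intro ψ χ he
  have hb : ψ.1 b = χ.1 b := Subtype.ext (congrArg (fun t : π.ker => (t : G)) he)
  have e1 := exp_apply (A := Subgroup.center G) e ψ.1
  have e2 := exp_apply (A := Subgroup.center G) e χ.1
  have e3 : ψ.1 c = χ.1 c := Subtype.ext ((ψ.2.2 c hc).trans (χ.2.2 c hc).symm)
  rw [e1, e2, hb] at e3
  have e4 : (ψ.1 a * (χ.1 a)⁻¹) ^ i = 1 := by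
    rw [mul_zpow, inv_zpow, mul_right_cancel e3, mul_inv_cancel]
  have hm : ((ψ.1 a * (χ.1 a)⁻¹ : Subgroup.center G) : G) ∈ π.ker :=
    π.ker.mul_mem (ψ.2.1 a) (π.ker.inv_mem (χ.2.1 a))
  have e5 : (ψ.1 a * (χ.1 a)⁻¹) ^ (Nat.card π.ker : ℤ) = 1 := by
    ext1
    have := pow_card_eq_one' (x := (⟨_, hm⟩ : π.ker))
    simpa using congrArg Subtype.val this
  have hcop : IsCoprime i (Nat.card π.ker : ℤ) := by
    have hpr : Prime (Nat.card π.ker : ℤ) := Nat.prime_iff_prime_int.1 hp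
    exact (hpr.irreducible.coprime_iff_not_dvd.2 hi).symm
  obtain ⟨k, l, hkl⟩ := hcop
  have e6 : ψ.1 a * (χ.1 a)⁻¹ = 1 := by
    rw [← zpow_one (ψ.1 a * (χ.1 a)⁻¹), ← hkl, zpow_add, mul_comm k, mul_comm l, zpow_mul, zpow_mul,
      e4, e5, one_zpow, one_zpow, one_mul]
  have ha : ψ.1 a = χ.1 a := mul_inv_eq_one.1 e6
  have ht := h.eq_top (MonoidHom.eqLocus ψ.1 χ.1) ha hb
  apply Subtype.ext
  ext1 g
  have : g ∈ MonoidHom.eqLocus ψ.1 χ.1 := by rw [ht]; trivial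
  exact this

theorem card_ret_le [Finite G] {a b : G} (h : Gen a b) (π : G →* B)
    (hp : (Nat.card π.ker).Prime) : Nat.card (Ret π) ≤ Nat.card π.ker := by
  have : Nontrivial π.ker := Finite.one_lt_card_iff_nontrivial.1 hp.one_lt
  obtain ⟨⟨c, hc⟩, hc1⟩ := exists_ne (1 : π.ker)
  obtain ⟨i, j, e⟩ := exists_exp h c
  by_cases hi : (Nat.card π.ker : ℤ) ∣ i
  · by_cases hj : (Nat.card π.ker : ℤ) ∣ j
    · rcases isEmpty_or_nonempty (Ret π) with hE | ⟨⟨ψ⟩⟩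
      · simp
      · exfalso
        apply hc1
        have e1 := exp_apply (A := Subgroup.center G) e ψ.1
        have hz : ∀ g, (ψ.1 g) ^ (Nat.card π.ker : ℤ) = 1 := by
          intro g
          ext1
          have := pow_card_eq_one' (x := (⟨_, ψ.2.1 g⟩ : π.ker))
          simpa using congrArg Subtype.val this
        obtain ⟨k, rfl⟩ := hi
        obtain ⟨l, rfl⟩ := hj
        rw [zpow_mul, zpow_mul, hz, hz, one_zpow, one_zpow, one_mul] at e1
        have := congrArg Subtype.val e1
        rw [ψ.2.2 c hc] at this
        exact Subtype.ext this
    · exact card_ret_aux h.swap π hp hc (by rw [e, mul_comm]) hj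
  · exact card_ret_aux h π hp hc e hi

theorem ret_empty {a b : G} (h : Gen a b) (π : G →* B) (hp : Nat.card π.ker = 2)
    (f : G →* V4) (hf : Function.Surjective f) (hle : π.ker ≤ f.ker) : IsEmpty (Ret π) := by
  constructor
  intro ψ
  have hz : ∀ g, (ψ.1 g) ^ 2 = 1 := by
    intro g
    ext1
    have := pow_card_eq_one' (x := (⟨_, ψ.2.1 g⟩ : π.ker))
    rw [hp] at this
    simpa using congrArg Subtype.val this
  have hk := ker_le h f hf ψ.1.ker (fun g => by
    rw [MonoidHom.mem_ker, map_mul, ← pow_two, hz])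
  have : π.ker = ⊥ := by
    rw [Subgroup.eq_bot_iff_forall]
    intro n hn
    have := hk (hle hn)
    rw [MonoidHom.mem_ker] at this
    rw [← ψ.2.2 n hn, this]; rfl
  rw [this] at hp
  simp at hp

theorem lift_odd [Finite G] [Finite B] {a b : G} (h : Gen a b) (π : G →* B)
    (hπ : Function.Surjective π)
    (hc : π.ker ≤ Subgroup.center G) {p : ℕ} (hp : p.Prime) (hcard : Nat.card π.ker = p) :
    (p - 1) * p * Nat.card (Pairs B) ≤ Nat.card (Pairs G) := by
  subst hcard
  have h1 := lift_count π hπ hc hp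
  have h2 := card_ret_le h π hp
  have h3 := hp.one_lt
  generalize Nat.card π.ker = p at *
  obtain ⟨q, rfl⟩ : ∃ q, p = q + 1 := ⟨p - 1, by omega⟩
  simp only [Nat.add_sub_cancel]
  nlinarith [Nat.mul_le_mul_left (Nat.card (Pairs B)) h2]

theorem lift_two [Finite G] [Finite B] {a b : G} (h : Gen a b) (π : G →* B)
    (hπ : Function.Surjective π)
    (hc : π.ker ≤ Subgroup.center G) (hcard : Nat.card π.ker = 2)
    (f : G →* V4) (hf : Function.Surjective f) (hle : π.ker ≤ f.ker) :
    4 * Nat.card (Pairs B) ≤ Nat.card (Pairs G) := by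
  have h1 := lift_count π hπ hc (by rw [hcard]; exact Nat.prime_two)
  have := ret_empty h π hcard f hf hle
  rw [hcard, Nat.card_of_isEmpty (α := Ret π)] at h1
  omega

end lifting


section isos
variable {G : Type*} [Group G]

theorem exists_pw (n : ℕ) [NeZero n] {r : G} (hr : r ^ n = 1) :
    ∃ e : Multiplicative (ZMod n) →* G, ∀ k : ℕ, e (Multiplicative.ofAdd (k : ZMod n)) = r ^ k := by
  refine ⟨MonoidHom.mk' (fun i => r ^ (i.toAdd).val) ?_, ?_⟩
  · intro i j
    rw [toAdd_mul, ZMod.val_add, ← pow_eq_pow_mod _ hr, pow_add]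
  · intro k
    change r ^ ((k : ZMod n)).val = r ^ k
    rw [ZMod.val_natCast, ← pow_eq_pow_mod _ hr]

theorem pw_surj (n : ℕ) [NeZero n] (i : Multiplicative (ZMod n)) :
    ∃ k : ℕ, i = Multiplicative.ofAdd (k : ZMod n) :=
  ⟨i.toAdd.val, by rw [ZMod.natCast_zmod_val]; rfl⟩

theorem iso_of_gen [Finite G] {Q : Type*} [Group Q] [Finite Q] (F : Q →* G)
    (hF : F.range = ⊤) (hcard : Nat.card Q ≤ Nat.card G) : Nonempty (G ≃* Q) := by
  have hs : Function.Surjective F := MonoidHom.range_eq_top.1 hF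
  have hb : Function.Bijective F :=
    hs.bijective_of_nat_card_le hcard
  exact ⟨(MulEquiv.ofBijective F hb).symm⟩

theorem iso_dihedral [Finite G] (n : ℕ) [NeZero n] {r x : G} (h : Gen r x) (hr : r ^ n = 1)
    (hx : x * x = 1) (hc : x * r * x⁻¹ = r⁻¹) (hcard : 2 * n ≤ Nat.card G) :
    Nonempty (G ≃* DihedralGroup n) := by
  obtain ⟨e, he⟩ := exists_pw n hr
  have xi : x⁻¹ = x := inv_eq_of_mul_eq_one_right hx
  have hce : ∀ i, x * e i = (e i)⁻¹ * x := by
    intro i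
    obtain ⟨k, rfl⟩ := pw_surj n i
    rw [he, ← mul_inv_eq_iff_eq_mul, ← conj_pow, hc, inv_pow]
  have hce' : ∀ i, e i * x = x * (e i)⁻¹ := by
    intro i
    have := hce i⁻¹
    rw [map_inv, inv_inv] at this
    exact this.symm
  let F : DihedralGroup n →* G := MonoidHom.mk' (fun d => match d with
    | DihedralGroup.r i => e (Multiplicative.ofAdd i)
    | DihedralGroup.sr i => x * e (Multiplicative.ofAdd i)) (by
    rintro (i | i) (j | j)
    · simp only [DihedralGroup.r_mul_r, ofAdd_add, map_mul]
    · simp only [DihedralGroup.r_mul_sr]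
      rw [← mul_assoc, hce', mul_assoc, ← map_inv, ← map_mul, ← ofAdd_neg, ← ofAdd_add]
      congr 3; ring
    · simp only [DihedralGroup.sr_mul_r, ofAdd_add, map_mul, mul_assoc]
    · simp only [DihedralGroup.sr_mul_sr]
      rw [hce, mul_assoc, ← mul_assoc x, hx, one_mul, ← map_inv, ← map_mul, ← ofAdd_neg,
        ← ofAdd_add]
      congr 2; ring)
  have : Finite (DihedralGroup n) := Finite.of_fintype _
  refine iso_of_gen F (h.eq_top _ ⟨DihedralGroup.r 1, ?_⟩ ⟨DihedralGroup.sr 0, ?_⟩) ?_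
  · have := he 1
    rw [Nat.cast_one, pow_one] at this
    exact this
  · change x * e (Multiplicative.ofAdd 0) = x
    rw [ofAdd_zero, map_one, mul_one]
  · rw [DihedralGroup.nat_card]; exact hcard

theorem iso_quaternion [Finite G] {r x : G} (h : Gen r x) (hr : r ^ 4 = 1)
    (hx : x * x = r ^ 2) (hc : x * r * x⁻¹ = r⁻¹) (hcard : 8 ≤ Nat.card G) :
    Nonempty (G ≃* QuaternionGroup 2) := by
  obtain ⟨e, he⟩ := exists_pw (2 * 2) (r := r) hr
  have hce : ∀ i, x * e i = (e i)⁻¹ * x := by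
    intro i
    obtain ⟨k, rfl⟩ := pw_surj (2 * 2) i
    rw [he, ← mul_inv_eq_iff_eq_mul, ← conj_pow, hc, inv_pow]
  have hce' : ∀ i, e i * x = x * (e i)⁻¹ := by
    intro i
    have := hce i⁻¹
    rw [map_inv, inv_inv] at this
    exact this.symm
  let F : QuaternionGroup 2 →* G := MonoidHom.mk' (fun d => match d with
    | QuaternionGroup.a i => e (Multiplicative.ofAdd i)
    | QuaternionGroup.xa i => x * e (Multiplicative.ofAdd i)) (by
    rintro (i | i) (j | j)
    · simp only [QuaternionGroup.a_mul_a, ofAdd_add, map_mul]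
    · simp only [QuaternionGroup.a_mul_xa]
      rw [← mul_assoc, hce', mul_assoc, ← map_inv, ← map_mul, ← ofAdd_neg, ← ofAdd_add]
      congr 3; ring
    · simp only [QuaternionGroup.xa_mul_a, ofAdd_add, map_mul, mul_assoc]
    · simp only [QuaternionGroup.xa_mul_xa]
      rw [hce, mul_assoc, ← mul_assoc x, hx, ← he 2, ← map_inv, ← map_mul, ← map_mul, ← ofAdd_neg,
        ← ofAdd_add, ← ofAdd_add]
      congr 2; ring)
  have : Finite (QuaternionGroup 2) := Finite.of_fintype _
  refine iso_of_gen F (h.eq_top _ ⟨QuaternionGroup.a 1, ?_⟩ ⟨QuaternionGroup.xa 0, ?_⟩) ?_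
  · have := he 1
    rw [Nat.cast_one, pow_one] at this
    exact this
  · change x * e (Multiplicative.ofAdd 0) = x
    rw [ofAdd_zero, map_one, mul_one]
  · rw [Nat.card_eq_fintype_card, QuaternionGroup.card]; exact hcard

theorem hom_prod (n m : ℕ) [NeZero n] [NeZero m] {x y : G} (hx : x ^ n = 1) (hy : y ^ m = 1)
    (hc : Commute x y) : ∃ F : Multiplicative (ZMod n × ZMod m) →* G,
      x ∈ F.range ∧ y ∈ F.range := by
  obtain ⟨e, he⟩ := exists_pw n hx
  obtain ⟨d, hd⟩ := exists_pw m hy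
  have hcom : ∀ i j, Commute (e i) (d j) := by
    intro i j
    obtain ⟨k, rfl⟩ := pw_surj n i
    obtain ⟨l, rfl⟩ := pw_surj m j
    rw [he, hd]
    exact hc.pow_pow _ _
  refine ⟨MonoidHom.mk' (fun t => e (Multiplicative.ofAdd t.toAdd.1) *
    d (Multiplicative.ofAdd t.toAdd.2)) ?_, ⟨Multiplicative.ofAdd (1, 0), ?_⟩,
      ⟨Multiplicative.ofAdd (0, 1), ?_⟩⟩
  · intro s t
    simp only [toAdd_mul, Prod.fst_add, Prod.snd_add, ofAdd_add, map_mul]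
    exact (hcom _ _).mul_mul_mul_comm _ _
  · have := he 1
    rw [Nat.cast_one, pow_one] at this
    simpa using this
  · have := hd 1
    rw [Nat.cast_one, pow_one] at this
    simpa using this

theorem hom_prod3 {x y c : G} (hx : x ^ 2 = 1) (hy : y ^ 2 = 1) (hc : c ^ 3 = 1)
    (hxy : Commute x y) (hxc : Commute x c) (hyc : Commute y c) :
    ∃ F : Multiplicative (ZMod 2 × ZMod 2 × ZMod 3) →* G,
      x ∈ F.range ∧ y ∈ F.range ∧ c ∈ F.range := by
  obtain ⟨e, he⟩ := exists_pw 2 hx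
  obtain ⟨d, hd⟩ := exists_pw 2 hy
  obtain ⟨k, hk⟩ := exists_pw 3 hc
  have hed : ∀ i j, Commute (e i) (d j) := by
    intro i j
    obtain ⟨k, rfl⟩ := pw_surj 2 i
    obtain ⟨l, rfl⟩ := pw_surj 2 j
    rw [he, hd]
    exact hxy.pow_pow _ _
  have hek : ∀ i j, Commute (e i) (k j) := by
    intro i j
    obtain ⟨a, rfl⟩ := pw_surj 2 i
    obtain ⟨l, rfl⟩ := pw_surj 3 j
    rw [he, hk]
    exact hxc.pow_pow _ _
  have hdk : ∀ i j, Commute (d i) (k j) := by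
    intro i j
    obtain ⟨a, rfl⟩ := pw_surj 2 i
    obtain ⟨l, rfl⟩ := pw_surj 3 j
    rw [hd, hk]
    exact hyc.pow_pow _ _
  refine ⟨MonoidHom.mk' (fun t => e (Multiplicative.ofAdd t.toAdd.1) *
    d (Multiplicative.ofAdd t.toAdd.2.1) * k (Multiplicative.ofAdd t.toAdd.2.2)) ?_,
      ⟨Multiplicative.ofAdd (1, 0, 0), ?_⟩,
      ⟨Multiplicative.ofAdd (0, 1, 0), ?_⟩, ⟨Multiplicative.ofAdd (0, 0, 1), ?_⟩⟩
  · intro s t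
    simp only [toAdd_mul, Prod.fst_add, Prod.snd_add, ofAdd_add, map_mul]
    rw [(hed _ _).mul_mul_mul_comm]
    exact ((hek _ _).mul_left (hdk _ _)).mul_mul_mul_comm _ _
  · have := he 1
    rw [Nat.cast_one, pow_one] at this
    simpa using this
  · have := hd 1
    rw [Nat.cast_one, pow_one] at this
    simpa using this
  · have := hk 1
    rw [Nat.cast_one, pow_one] at this
    simpa using this

end isos


section small
variable {G : Type*} [Group G]

theorem card_eq_four_mul [Finite G] (f : G →* V4) (hf : Function.Surjective f) :
    Nat.card G = 4 * Nat.card f.ker := by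
  have h1 := f.ker.card_mul_index
  rw [Subgroup.index_ker, MonoidHom.range_eq_top.2 hf, Subgroup.card_top] at h1
  have : Nat.card V4 = 4 := by rw [Nat.card_eq_fintype_card]; decide
  rw [this] at h1
  omega

theorem order8 [Finite G] {x y : G} (h : Gen x y) (f : G →* V4) (hf : Function.Surjective f)
    (hc : f.ker ≤ Subgroup.center G) (h2 : Nat.card f.ker = 2) :
    Nonempty (G ≃* Multiplicative (ZMod 4 × ZMod 2)) ∨ Nonempty (G ≃* DihedralGroup 4) ∨
    Nonempty (G ≃* QuaternionGroup 2) := by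
  have h8 : Nat.card G = 8 := by rw [card_eq_four_mul f hf, h2]
  obtain ⟨⟨z, hz⟩, hz1, hzu⟩ := (Nat.card_eq_two_iff' (1 : f.ker)).1 h2
  have hz1' : z ≠ 1 := fun e => hz1 (Subtype.ext e)
  have hk : ∀ g, f g = 1 → g = 1 ∨ g = z := by
    intro g hg
    by_cases e : g = 1
    · exact Or.inl e
    · right
      have := hzu ⟨g, hg⟩ (fun e' => e (congrArg Subtype.val e'))
      exact congrArg Subtype.val this
  have zc : ∀ g, g * z = z * g := Subgroup.mem_center_iff.1 (hc hz)
  have zz : z * z = 1 := by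
    rcases hk (z * z) (by rw [map_mul, V4_sq]) with e | e
    · exact e
    · exact absurd (mul_eq_left.1 e) hz1'
  have hx := hk (x * x) (by rw [map_mul, V4_sq])
  have hy := hk (y * y) (by rw [map_mul, V4_sq])
  have hxy := hk (x * y * x⁻¹ * y⁻¹) (by simp)
  have c42 : ∀ {u v : G}, Gen u v → u * u = z → v * v = 1 → Commute u v →
      Nonempty (G ≃* Multiplicative (ZMod 4 × ZMod 2)) := by
    intro u v huv hu hv hcom
    obtain ⟨F, h1, h2⟩ := hom_prod 4 2 (x := u) (y := v)
      (by rw [show 4 = 2 * 2 by rfl, pow_mul, pow_two, pow_two, hu, zz]) (by rw [pow_two, hv]) hcom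
    refine iso_of_gen F (huv.eq_top _ h1 h2) ?_
    rw [h8, Nat.card_eq_fintype_card]; decide
  have d4 : ∀ {r s : G}, Gen r s → r * r = z → s * s = 1 → s * r * s⁻¹ = r⁻¹ →
      Nonempty (G ≃* DihedralGroup 4) := by
    intro r s hrs hr hs hcon
    exact iso_dihedral 4 hrs (by rw [show 4 = 2 * 2 by rfl, pow_mul, pow_two, pow_two, hr, zz]) hs
      hcon (by rw [h8])
  have inv_z : ∀ {r : G}, r * r = z → r⁻¹ = z * r := by
    intro r hr
    apply inv_eq_of_mul_eq_one_left
    rw [mul_assoc, hr, zz]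
  rcases hxy with hxy | hxy
  · have hcom : Commute x y := by
      rw [mul_inv_eq_one, mul_inv_eq_iff_eq_mul] at hxy
      exact hxy
    left
    rcases hx with hx | hx <;> rcases hy with hy | hy
    · exfalso
      obtain ⟨F, h1, h2⟩ := hom_prod 2 2 (x := x) (y := y) (by rw [pow_two, hx])
        (by rw [pow_two, hy]) hcom
      have hs := MonoidHom.range_eq_top.1 (h.eq_top _ h1 h2)
      have := Nat.card_le_card_of_surjective F hs
      rw [h8, Nat.card_eq_fintype_card] at this
      revert this; decide
    · exact c42 h.swap hy hx hcom.symm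
    · exact c42 h hx hy hcom
    · refine c42 (u := x) (v := x * y) (h.of_mem' fun K h1 h2 =>
        ⟨h1, by simpa using K.mul_mem (K.inv_mem h1) h2⟩) hx ?_ ((Commute.refl x).mul_right hcom)
      rw [hcom.symm.mul_mul_mul_comm, hx, hy, zz]
  · right
    have e1 : x * y * x⁻¹ = z * y := mul_inv_eq_iff_eq_mul.1 hxy
    have e2 : y * x * y⁻¹ = z * x := by
      have : y * x * y⁻¹ = (x * y * x⁻¹ * y⁻¹)⁻¹ * x := by group
      rw [this, hxy, inv_eq_of_mul_eq_one_right zz]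
    rcases hx with hx | hx <;> rcases hy with hy | hy
    · left
      have xi : x⁻¹ = x := inv_eq_of_mul_eq_one_right hx
      have yi : y⁻¹ = y := inv_eq_of_mul_eq_one_right hy
      refine d4 (r := x * y) (s := x) (h.of_mem' fun K h1 h2 =>
        ⟨h2, by simpa using K.mul_mem (K.inv_mem h2) h1⟩) ?_ hx ?_
      · rw [xi, yi] at hxy
        rw [← hxy]; group
      · rw [mul_inv_rev, yi, ← mul_assoc, hx, one_mul]
    · left
      exact d4 h.swap hy hx (by rw [e1, inv_z hy])
    · left
      exact d4 h hx hy (by rw [e2, inv_z hx])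
    · right
      exact iso_quaternion h (by rw [show 4 = 2 * 2 by rfl, pow_mul, pow_two, pow_two, hx, zz])
        (by rw [pow_two, hx, hy]) (by rw [e2, inv_z hx]) (by rw [h8])

theorem order12 [Finite G] {a b : G} (h : Gen a b) (f : G →* V4) (hf : Function.Surjective f)
    (hc : f.ker ≤ Subgroup.center G) (h3 : Nat.card f.ker = 3) :
    Nonempty (G ≃* Multiplicative (ZMod 2 × ZMod 2 × ZMod 3)) := by
  have h12 : Nat.card G = 12 := by rw [card_eq_four_mul f hf, h3]
  have cube : ∀ g, f g = 1 → g ^ 3 = 1 := by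
    intro g hg
    have := pow_card_eq_one' (x := (⟨g, hg⟩ : f.ker))
    rw [h3] at this
    simpa using congrArg Subtype.val this
  have cen : ∀ g, f g = 1 → ∀ k, k * g = g * k := fun g hg => Subgroup.mem_center_iff.1 (hc hg)
  have sqk : ∀ g, f (g * g) = 1 := fun g => by rw [map_mul, V4_sq]
  have hcom : Commute a b := by
    obtain ⟨d, hd⟩ : ∃ d, d = a * b * a⁻¹ * b⁻¹ := ⟨_, rfl⟩
    have fd : f d = 1 := by rw [hd]; simp
    have e1 : a * b * a⁻¹ = d * b := by rw [hd]; group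
    have e2 : a * a * b * (a * a)⁻¹ = d * d * b := by
      calc _ = a * (a * b * a⁻¹) * a⁻¹ := by group
        _ = a * d * (b * a⁻¹) := by rw [e1]; group
        _ = d * (a * b * a⁻¹) := by rw [cen d fd]; group
        _ = _ := by rw [e1]; group
    have e3 : a * a * b * (a * a)⁻¹ = b := by
      rw [← cen _ (sqk a) b]; group
    have e4 : d * d = 1 := by
      rw [e3] at e2
      exact mul_eq_right.1 e2.symm
    have e5 := cube d fd
    rw [pow_succ, pow_two, e4, one_mul] at e5
    rw [e5, one_mul] at e1
    exact mul_inv_eq_iff_eq_mul.1 e1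
  have : Nontrivial f.ker := Finite.one_lt_card_iff_nontrivial.1 (by omega)
  obtain ⟨⟨c, hck⟩, hc1⟩ := exists_ne (1 : f.ker)
  have hz : ∀ g, f g = 1 → g ∈ Subgroup.zpowers c := by
    intro g hg
    have : Fact (Nat.Prime 3) := ⟨Nat.prime_three⟩
    have := mem_zpowers_of_prime_card h3 hc1 (g' := ⟨g, hg⟩)
    obtain ⟨k, hk⟩ := this
    exact ⟨k, by simpa using congrArg Subtype.val hk⟩
  obtain ⟨F, h1, h2, h4⟩ := hom_prod3 (x := a ^ 3) (y := b ^ 3) (c := c)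
    (by rw [← pow_mul, mul_comm, pow_mul, pow_two]; exact cube _ (sqk a))
    (by rw [← pow_mul, mul_comm, pow_mul, pow_two]; exact cube _ (sqk b))
    (cube c hck) (hcom.pow_pow 3 3) (cen c hck _) (cen c hck _)
  have hle : Subgroup.zpowers c ≤ F.range := by rwa [Subgroup.zpowers_le]
  refine iso_of_gen F (h.eq_top _ ?_ ?_) ?_
  · have e : a = a ^ 3 * (a * a)⁻¹ := by rw [pow_succ, pow_two]; group
    rw [e]
    exact F.range.mul_mem h1 (F.range.inv_mem (hle (hz _ (sqk a))))
  · have e : b = b ^ 3 * (b * b)⁻¹ := by rw [pow_succ, pow_two]; group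
    rw [e]
    exact F.range.mul_mem h2 (F.range.inv_mem (hle (hz _ (sqk b))))
  · rw [h12, Nat.card_eq_fintype_card]; decide

end small


section trivialM
variable {G : Type*} [Group G]

theorem quot_center (f : G →* V4) (hM : ∀ g ∈ Subgroup.center G, f g = 1 → g = 1) :
    Subgroup.center (G ⧸ Subgroup.center G) = ⊥ := by
  rw [Subgroup.eq_bot_iff_forall]
  intro q hq
  induction q using QuotientGroup.induction_on with
  | H g =>
    rw [QuotientGroup.eq_one_iff, Subgroup.mem_center_iff]
    intro k
    have h1 := Subgroup.mem_center_iff.1 hq (k : G ⧸ Subgroup.center G)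
    rw [← QuotientGroup.mk_mul, ← QuotientGroup.mk_mul, QuotientGroup.eq] at h1
    have h2 := hM _ h1 (by rw [map_mul, map_inv, map_mul, map_mul, mul_comm (f g), inv_mul_cancel])
    exact inv_mul_eq_one.1 h2

theorem V4_char : ∀ w : V4, ∃ χ : V4 →* Multiplicative (ZMod 2), χ w = 1 ∧ χ ≠ 1 := by
  intro w
  have ne : ∀ (χ : V4 →* Multiplicative (ZMod 2)) (u : V4), χ u ≠ 1 → χ ≠ 1 := by
    rintro χ u hu rfl
    exact hu rfl
  by_cases h1 : w.toAdd.1 = 0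
  · exact ⟨AddMonoidHom.toMultiplicative (AddMonoidHom.fst _ _), h1,
      ne _ (Multiplicative.ofAdd (1, 0)) (by decide)⟩
  · by_cases h2 : w.toAdd.2 = 0
    · exact ⟨AddMonoidHom.toMultiplicative (AddMonoidHom.snd _ _), h2,
        ne _ (Multiplicative.ofAdd (0, 1)) (by decide)⟩
    · refine ⟨AddMonoidHom.toMultiplicative (AddMonoidHom.fst _ _ + AddMonoidHom.snd _ _), ?_,
        ne _ (Multiplicative.ofAdd (0, 1)) (by decide)⟩
      change w.toAdd.1 + w.toAdd.2 = 0
      generalize w.toAdd.1 = s at *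
      generalize w.toAdd.2 = t at *
      revert s t
      decide

theorem card_two_case [Finite G] {a b : G} (h : Gen a b) (f : G →* V4)
    (hf : Function.Surjective f) (hM : ∀ g ∈ Subgroup.center G, f g = 1 → g = 1)
    (h2 : Nat.card (Subgroup.center G) = 2) :
    6 * Nat.card G ≤ Nat.card (Pairs G) ∨
      (3 * Nat.card G ≤ Nat.card (Pairs G) ∧ Nonempty (G ≃* DihedralGroup 6)) := by
  obtain ⟨⟨z, hz⟩, hz1, hzu⟩ := (Nat.card_eq_two_iff' (1 : Subgroup.center G)).1 h2
  have hk : ∀ g ∈ Subgroup.center G, g = 1 ∨ g = z := by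
    intro g hg
    by_cases e : g = 1
    · exact Or.inl e
    · right
      have := hzu ⟨g, hg⟩ (fun e' => e (congrArg Subtype.val e'))
      exact congrArg Subtype.val this
  have zc : ∀ g, g * z = z * g := Subgroup.mem_center_iff.1 hz
  have zz : z * z = 1 := hM _ (Subgroup.mul_mem _ hz hz) (by rw [map_mul, V4_sq])
  let π := QuotientGroup.mk' (Subgroup.center G)
  have hπ : Function.Surjective π := QuotientGroup.mk'_surjective _
  have kerπ : π.ker = Subgroup.center G := QuotientGroup.ker_mk' _
  have πZ : ∀ g, π g = 1 → g ∈ Subgroup.center G := fun g hg => (QuotientGroup.eq_one_iff g).1 hg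
  have hB := quot_center f hM
  have hGB : Nat.card G = Nat.card (G ⧸ Subgroup.center G) * 2 := by
    rw [← h2]; exact Subgroup.card_eq_card_quotient_mul_card_subgroup _
  have hl := lift_odd h π hπ kerπ.le Nat.prime_two (by rw [kerπ, h2])
  obtain ⟨χ0, e0, n0⟩ := V4_char (f z)
  let χ : (G ⧸ Subgroup.center G) →* Multiplicative (ZMod 2) :=
    QuotientGroup.lift _ (χ0.comp f) (by
      intro g hg
      rcases hk g hg with rfl | rfl
      · simp
      · exact e0)
  have hχ : χ ≠ 1 := by
    intro e
    apply n0
    refine MonoidHom.ext fun u => ?_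
    obtain ⟨g, rfl⟩ := hf u
    exact DFunLike.congr_fun e (π g)
  have gB := h.map π hπ
  obtain ⟨c3, c6⟩ := cls_of_C2 gB χ hχ
  have hcls := card_cls_mul_le hB
  by_cases hlt : 6 ≤ Nat.card (Cls (G ⧸ Subgroup.center G))
  · left
    have := Nat.mul_le_mul_right (Nat.card (G ⧸ Subgroup.center G)) hlt
    omega
  right
  refine ⟨?_, ?_⟩
  · have := Nat.mul_le_mul_right (Nat.card (G ⧸ Subgroup.center G)) c3
    omega
  have hle3 := c6 (by omega)
  have : Nontrivial (G ⧸ Subgroup.center G) := by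
    by_contra hnt
    rw [not_nontrivial_iff_subsingleton] at hnt
    apply hχ
    refine MonoidHom.ext fun u => ?_
    rw [Subsingleton.elim u 1, map_one, map_one]
  obtain ⟨x', y', g', x2, y3, xy, x1, y1, -⟩ := structD hB hle3 (core hB hle3 gB)
  have h6 : 6 ≤ Nat.card (G ⧸ Subgroup.center G) := by
    have : Fact (Nat.Prime 3) := ⟨Nat.prime_three⟩
    have o2 : orderOf x' = 2 := orderOf_eq_prime x2 x1
    have o3 : orderOf y' = 3 := orderOf_eq_prime y3 y1
    have d2 := orderOf_dvd_natCard x'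
    have d3 := orderOf_dvd_natCard y'
    have hpos : 0 < Nat.card (G ⧸ Subgroup.center G) := Nat.card_pos
    rw [o2] at d2
    rw [o3] at d3
    omega
  obtain ⟨x, rfl⟩ := hπ x'
  obtain ⟨y0, rfl⟩ := hπ y'
  have πz : π z = 1 := (QuotientGroup.eq_one_iff z).2 hz
  obtain ⟨y, hy, hy3⟩ : ∃ y, π y = π y0 ∧ y ^ 3 = 1 := by
    rcases hk (y0 ^ 3) (πZ _ (by rw [map_pow, y3])) with e | e
    · exact ⟨y0, rfl, e⟩
    · refine ⟨y0 * z, by rw [map_mul, πz, mul_one], ?_⟩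
      rw [Commute.mul_pow (zc y0), e, pow_succ, pow_two, zz, one_mul, zz]
  rw [← hy] at xy g' y1
  have hx2 : x * x = 1 := hM _ (πZ _ (by rw [map_mul, ← pow_two, x2])) (by rw [map_mul, V4_sq])
  have hxy : x * y * x⁻¹ = y⁻¹ := by
    have : x * y * x⁻¹ * y = 1 := by
      apply hM
      · apply πZ
        rw [map_mul, map_mul, map_mul, map_inv, xy, inv_mul_cancel]
      · rw [map_mul, map_mul, map_mul, map_inv, mul_inv_cancel_comm, V4_sq]
    exact eq_inv_of_mul_eq_one_left this
  have z2 : z ^ 2 = 1 := by rw [pow_two, zz]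
  have z3 : z ^ 3 = z := by rw [pow_succ, z2, one_mul]
  have hcy : Commute y z := zc y
  refine iso_dihedral 6 (r := y * z) (x := x) ?_ ?_ hx2 ?_ (by omega)
  · unfold Gen
    set K := Subgroup.closure ({y * z, x} : Set G) with hK
    have k1 : y * z ∈ K := mem_cl_left _ _
    have k2 : x ∈ K := mem_cl_right _ _
    have kz : z ∈ K := by
      have := K.pow_mem k1 3
      rwa [hcy.mul_pow, hy3, one_mul, z3] at this
    have ky : y ∈ K := by simpa using K.mul_mem k1 (K.inv_mem kz)
    have hmap : K.map π = ⊤ := g'.eq_top _ ⟨x, k2, rfl⟩ ⟨y, ky, rfl⟩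
    rw [Subgroup.eq_top_iff']
    intro g
    have : π g ∈ K.map π := by rw [hmap]; trivial
    obtain ⟨k, hk1, hk2⟩ := this
    have : k⁻¹ * g ∈ K := by
      rcases hk _ (πZ (k⁻¹ * g) (by rw [map_mul, map_inv, hk2, inv_mul_cancel])) with e | e
      · rw [e]; exact K.one_mem
      · rw [e]; exact kz
    simpa using K.mul_mem hk1 this
  · rw [hcy.mul_pow, show 6 = 3 * 2 by rfl, pow_mul, hy3, mul_comm 3 2, pow_mul, z2, one_pow,
      one_pow, one_mul]
  · rw [mul_inv_rev, inv_eq_of_mul_eq_one_right zz, ← hxy]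
    calc x * (y * z) * x⁻¹ = x * y * (z * x⁻¹) := by group
      _ = x * y * (x⁻¹ * z) := by rw [zc]
      _ = _ := by rw [← zc]; group

theorem card_four_case [Finite G] {a b : G} (h : Gen a b) (f : G →* V4)
    (hf : Function.Surjective f) (hM : ∀ g ∈ Subgroup.center G, f g = 1 → g = 1)
    (h4 : Nat.card (Subgroup.center G) = 4) :
    6 * Nat.card G ≤ Nat.card (Pairs G) ∨ (Nat.card G = 4 ∧ 6 ≤ Nat.card (Pairs G)) := by
  let π := QuotientGroup.mk' (Subgroup.center G)
  have hπ : Function.Surjective π := QuotientGroup.mk'_surjective _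
  have πZ : ∀ g, π g = 1 → g ∈ Subgroup.center G := fun g hg => (QuotientGroup.eq_one_iff g).1 hg
  have Zπ : ∀ g, g ∈ Subgroup.center G → π g = 1 := fun g hg => (QuotientGroup.eq_one_iff g).2 hg
  have hB := quot_center f hM
  have hGB : Nat.card G = Nat.card (G ⧸ Subgroup.center G) * 4 := by
    rw [← h4]; exact Subgroup.card_eq_card_quotient_mul_card_subgroup _
  have gB := h.map π hπ
  have hZs : ∀ s : V4, ∃ ζ ∈ Subgroup.center G, f ζ = s := by
    let fZ : Subgroup.center G →* V4 := f.comp (Subgroup.center G).subtype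
    have inj : Function.Injective fZ := by
      rw [injective_iff_map_eq_one]
      intro g hg
      exact Subtype.ext (hM g g.2 hg)
    have : Nat.card V4 = 4 := by rw [Nat.card_eq_fintype_card]; decide
    have hbij := inj.bijective_of_nat_card_le (by rw [h4, this])
    intro s
    obtain ⟨ζ, hζ⟩ := hbij.2 s
    exact ⟨ζ, ζ.2, hζ⟩
  have hlift : ∀ (s : V4) (q : G ⧸ Subgroup.center G), ∃ u : G, f u = s ∧ π u = q := by
    intro s q
    obtain ⟨u, rfl⟩ := hπ q
    obtain ⟨ζ, hζ, e⟩ := hZs ((f u)⁻¹ * s)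
    exact ⟨u * ζ, by rw [map_mul, e, mul_inv_cancel_left], by rw [map_mul, Zπ ζ hζ, mul_one]⟩
  have hgen : ∀ u v : G, Gen (f u) (f v) → Gen (π u) (π v) → Gen u v := by
    intro u v h1 h2
    unfold Gen
    set K := Subgroup.closure ({u, v} : Set G) with hK
    have m1 : K.map f = ⊤ := h1.eq_top _ ⟨u, mem_cl_left _ _, rfl⟩ ⟨v, mem_cl_right _ _, rfl⟩
    have m2 : K.map π = ⊤ := h2.eq_top _ ⟨u, mem_cl_left _ _, rfl⟩ ⟨v, mem_cl_right _ _, rfl⟩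
    have hle : f.ker ≤ K := by
      apply ker_le h f hf
      intro g
      have : π g ∈ K.map π := by rw [m2]; trivial
      obtain ⟨k, hk1, hk2⟩ := this
      have hζ : k⁻¹ * g ∈ Subgroup.center G :=
        πZ _ (by rw [map_mul, map_inv, hk2, inv_mul_cancel])
      obtain ⟨ζ, e⟩ : ∃ ζ, ζ = k⁻¹ * g := ⟨_, rfl⟩
      rw [← e] at hζ
      have eg : g = k * ζ := by rw [e]; group
      have zz : ζ * ζ = 1 := hM _ (Subgroup.mul_mem _ hζ hζ) (by rw [map_mul, V4_sq])
      have hcz : Commute ζ k := (Subgroup.mem_center_iff.1 hζ k).symm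
      rw [eg, hcz.mul_mul_mul_comm, zz, mul_one]
      exact K.mul_mem hk1 hk1
    rw [Subgroup.eq_top_iff']
    intro g
    have : f g ∈ K.map f := by rw [m1]; trivial
    obtain ⟨k, hk1, hk2⟩ := this
    have : k⁻¹ * g ∈ K := hle (by rw [MonoidHom.mem_ker, map_mul, map_inv, hk2, inv_mul_cancel])
    simpa using K.mul_mem hk1 this
  choose L hL1 hL2 using hlift
  have hcount : 6 * Nat.card (Pairs (G ⧸ Subgroup.center G)) ≤ Nat.card (Pairs G) := by
    rw [← card_Lab, ← Nat.card_prod]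
    let F : Lab × Pairs (G ⧸ Subgroup.center G) → Pairs G := fun t =>
      ⟨(L t.1.1.1 t.2.1.1, L t.1.1.2 t.2.1.2), hgen _ _
        (by rw [hL1, hL1]; exact (V4_gen_iff _ _).2 t.1.2) (by rw [hL2, hL2]; exact t.2.2)⟩
    refine Nat.card_le_card_of_injective F ?_
    rintro ⟨⟨⟨s1, s2⟩, hs⟩, ⟨⟨q1, q2⟩, hq⟩⟩ ⟨⟨⟨s1', s2'⟩, hs'⟩, ⟨⟨q1', q2'⟩, hq'⟩⟩ e
    have e1 : L s1 q1 = L s1' q1' := congrArg (fun t : Pairs G => t.1.1) e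
    have e2 : L s2 q2 = L s2' q2' := congrArg (fun t : Pairs G => t.1.2) e
    have a1 : s1 = s1' := by rw [← hL1 s1 q1, e1, hL1]
    have a2 : s2 = s2' := by rw [← hL1 s2 q2, e2, hL1]
    have b1 : q1 = q1' := by rw [← hL2 s1 q1, e1, hL2]
    have b2 : q2 = q2' := by rw [← hL2 s2 q2, e2, hL2]
    subst a1 a2 b1 b2
    rfl
  rcases subsingleton_or_nontrivial (G ⧸ Subgroup.center G) with hs | hnt
  · right
    have h1 : Nat.card (G ⧸ Subgroup.center G) = 1 := Nat.card_eq_one_iff_unique.2 ⟨hs, ⟨1⟩⟩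
    have : Nonempty (Pairs (G ⧸ Subgroup.center G)) := ⟨⟨(π a, π b), gB⟩⟩
    have hpos : 0 < Nat.card (Pairs (G ⧸ Subgroup.center G)) := Nat.card_pos
    omega
  · left
    have hcls := card_cls_mul_le hB
    have h4' : 4 ≤ Nat.card (Cls (G ⧸ Subgroup.center G)) := by
      by_contra hlt
      have hle3 : Nat.card (Cls (G ⧸ Subgroup.center G)) ≤ 3 := by omega
      obtain ⟨-, -, -, -, -, -, -, -, A, hA, hsq⟩ := structD hB hle3 (core hB hle3 gB)
      apply hA
      have hle := ker_le h f hf (A.comap π) (fun g => by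
        rw [Subgroup.mem_comap, map_mul, ← pow_two]; exact hsq _)
      rw [Subgroup.eq_top_iff']
      intro q
      obtain ⟨g, rfl⟩ := hπ q
      obtain ⟨ζ, hζ, e⟩ := hZs (f g)
      have : g * ζ⁻¹ ∈ A.comap π := hle (by rw [MonoidHom.mem_ker, map_mul, map_inv, e,
        mul_inv_cancel])
      rwa [Subgroup.mem_comap, map_mul, map_inv, Zπ ζ hζ, inv_one, mul_one] at this
    have := Nat.mul_le_mul_right (Nat.card (G ⧸ Subgroup.center G)) h4'
    omega

theorem trivialM_case [Finite G] {a b : G} (h : Gen a b) (f : G →* V4)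
    (hf : Function.Surjective f) (hM : ∀ g ∈ Subgroup.center G, f g = 1 → g = 1) :
    6 * Nat.card G ≤ Nat.card (Pairs G) ∨ (Nat.card G = 4 ∧ 6 ≤ Nat.card (Pairs G)) ∨
      (3 * Nat.card G ≤ Nat.card (Pairs G) ∧ Nonempty (G ≃* DihedralGroup 6)) := by
  have hdvd : Nat.card (Subgroup.center G) ∣ 4 := by
    let fZ : Subgroup.center G →* V4 := f.comp (Subgroup.center G).subtype
    have inj : Function.Injective fZ := by
      rw [injective_iff_map_eq_one]
      intro g hg
      exact Subtype.ext (hM g g.2 hg)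
    have h4 : Nat.card V4 = 4 := by rw [Nat.card_eq_fintype_card]; decide
    have := Subgroup.card_dvd_of_injective fZ inj
    rwa [h4] at this
  have hle := Nat.le_of_dvd (by norm_num) hdvd
  have hcases : Nat.card (Subgroup.center G) = 1 ∨ Nat.card (Subgroup.center G) = 2 ∨
      Nat.card (Subgroup.center G) = 4 := by
    generalize Nat.card (Subgroup.center G) = n at *
    interval_cases n <;> simp_all
  rcases hcases with h1 | h1 | h1
  · left
    have hZ : Subgroup.center G = ⊥ := Subgroup.eq_bot_of_card_eq _ h1
    exact (Nat.mul_le_mul_right _ (six_le_cls h f hf)).trans (card_cls_mul_le hZ)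
  · rcases card_two_case h f hf hM h1 with h2 | h2
    · exact Or.inl h2
    · exact Or.inr (Or.inr h2)
  · rcases card_four_case h f hf hM h1 with h2 | h2
    · exact Or.inl h2
    · exact Or.inr (Or.inl h2)

end trivialM


section final
universe u

theorem step {G : Type u} [Group G] [Finite G] {a b : G} (h : Gen a b) (f : G →* V4)
    (hf : Function.Surjective f) (hM : ¬ ∀ g ∈ Subgroup.center G, f g = 1 → g = 1) :
    ∃ (N : Subgroup G) (_ : N.Normal) (p : ℕ), p.Prime ∧ Nat.card N = p ∧
      N ≤ Subgroup.center G ∧ N ≤ f.ker ∧ Nat.card G = p * Nat.card (G ⧸ N) ∧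
      2 * p * Nat.card (Pairs (G ⧸ N)) ≤ Nat.card (Pairs G) ∧
      (p - 1) * p * Nat.card (Pairs (G ⧸ N)) ≤ Nat.card (Pairs G) ∧
      (∃ a' b' : G ⧸ N, Gen a' b') ∧ ∃ f' : G ⧸ N →* V4, Function.Surjective f' := by
  push Not at hM
  obtain ⟨g, hg1, hg2, hg3⟩ := hM
  set M : Subgroup G := Subgroup.center G ⊓ f.ker with hMdef
  have hgM : g ∈ M := ⟨hg1, hg2⟩
  have hM1 : Nat.card M ≠ 1 := by
    intro e
    have := Subgroup.eq_bot_of_card_eq _ e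
    rw [this, Subgroup.mem_bot] at hgM
    exact hg3 hgM
  obtain ⟨p, hp, hpd⟩ := Nat.exists_prime_and_dvd hM1
  have : Fact p.Prime := ⟨hp⟩
  obtain ⟨c, hc⟩ := exists_prime_orderOf_dvd_card' p hpd
  have hcM : Subgroup.zpowers (c : G) ≤ M := by
    rw [Subgroup.zpowers_le]; exact c.2
  have hZ : Subgroup.zpowers (c : G) ≤ Subgroup.center G := hcM.trans inf_le_left
  have hK : Subgroup.zpowers (c : G) ≤ f.ker := hcM.trans inf_le_right
  have hcard : Nat.card (Subgroup.zpowers (c : G)) = p := by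
    rw [Nat.card_zpowers, Subgroup.orderOf_coe, hc]
  generalize Subgroup.zpowers (c : G) = N at *
  have hN : N.Normal := by
    constructor
    intro n hn k
    have := Subgroup.mem_center_iff.1 (hZ hn) k
    rw [this, mul_inv_cancel_right]
    exact hn
  let π := QuotientGroup.mk' N
  have hπ : Function.Surjective π := QuotientGroup.mk'_surjective _
  have kerπ : π.ker = N := QuotientGroup.ker_mk' _
  have hodd := lift_odd h π hπ (by rw [kerπ]; exact hZ) hp (by rw [kerπ, hcard])
  refine ⟨N, hN, p, hp, hcard, hZ, hK, ?_, ?_, hodd, ⟨_, _, h.map π hπ⟩,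
    QuotientGroup.lift N f hK, ?_⟩
  · rw [← hcard, mul_comm]; exact Subgroup.card_eq_card_quotient_mul_card_subgroup _
  · rcases hp.eq_two_or_odd with e | e
    · have := lift_two h π hπ (by rw [kerπ]; exact hZ) (by rw [kerπ, hcard, e]) f hf
        (by rw [kerπ]; exact hK)
      rw [e]; exact this
    · have h3 : 2 ≤ p - 1 := by
        have := hp.two_le
        omega
      refine le_trans ?_ hodd
      exact Nat.mul_le_mul_right _ (Nat.mul_le_mul_right _ h3)
  · intro v
    obtain ⟨g, rfl⟩ := hf v
    exact ⟨π g, rfl⟩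

theorem ratio (n : ℕ) : ∀ (G : Type u) [Group G] [Finite G], Nat.card G = n →
    ∀ {a b : G}, Gen a b → ∀ f : G →* V4, Function.Surjective f →
      3 * Nat.card G ≤ 2 * Nat.card (Pairs G) ∧
        (Nat.card (Pairs G) < 3 * Nat.card G → Nat.card G = 4 ∧ 6 ≤ Nat.card (Pairs G)) := by
  induction n using Nat.strong_induction_on with
  | _ n ih =>
    intro G _ _ hn a b h f hf
    have hpos : 0 < Nat.card G := Nat.card_pos
    by_cases hM : ∀ g ∈ Subgroup.center G, f g = 1 → g = 1
    · rcases trivialM_case h f hf hM with h1 | h1 | ⟨h1, -⟩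
      · omega
      · omega
      · omega
    · obtain ⟨N, hN, p, hp, -, -, -, hc, h2, -, ⟨a', b', h'⟩, f', hf'⟩ := step h f hf hM
      have hBpos : 0 < Nat.card (G ⧸ N) := Nat.card_pos
      have hlt : Nat.card (G ⧸ N) < n := by
        rw [← hn, hc]
        have := hp.two_le
        nlinarith
      obtain ⟨i1, -⟩ := ih _ hlt (G ⧸ N) rfl h' f' hf'
      have : 3 * Nat.card G ≤ Nat.card (Pairs G) := by
        rw [hc]
        refine le_trans ?_ h2
        calc 3 * (p * Nat.card (G ⧸ N)) = p * (3 * Nat.card (G ⧸ N)) := by ring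
          _ ≤ p * (2 * Nat.card (Pairs (G ⧸ N))) := Nat.mul_le_mul_left _ i1
          _ = _ := by ring
      omega

theorem main {G : Type u} [Group G] [Finite G] {a b : G} (h : Gen a b) (f : G →* V4)
    (hf : Function.Surjective f) (hlt : Nat.card (Pairs G) < 6 * Nat.card G) :
    Nonempty (G ≃* Multiplicative (ZMod 2 × ZMod 2)) ∨
    Nonempty (G ≃* Multiplicative (ZMod 4 × ZMod 2)) ∨
    Nonempty (G ≃* DihedralGroup 4) ∨
    Nonempty (G ≃* QuaternionGroup 2) ∨
    Nonempty (G ≃* DihedralGroup 6) ∨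
    Nonempty (G ≃* Multiplicative (ZMod 2 × ZMod 2 × ZMod 3)) := by
  by_cases hM : ∀ g ∈ Subgroup.center G, f g = 1 → g = 1
  · rcases trivialM_case h f hf hM with h1 | ⟨h1, -⟩ | ⟨-, h1⟩
    · omega
    · left
      have : Nat.card V4 = 4 := by rw [Nat.card_eq_fintype_card]; decide
      exact ⟨MulEquiv.ofBijective f (hf.bijective_of_nat_card_le (by rw [h1, this]))⟩
    · exact Or.inr (Or.inr (Or.inr (Or.inr (Or.inl h1))))
  · obtain ⟨N, hN, p, hp, hcN, hZ, hK, hc, h2, h3, ⟨a', b', h'⟩, f', hf'⟩ := step h f hf hM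
    have hr := (ratio _ (G ⧸ N) rfl h' f' hf').2
    have hppos := hp.pos
    have hB : Nat.card (Pairs (G ⧸ N)) < 3 * Nat.card (G ⧸ N) := by
      by_contra hge
      push Not at hge
      have := Nat.mul_le_mul_left (2 * p) hge
      rw [hc] at hlt
      nlinarith
    obtain ⟨h4, h6⟩ := hr hB
    rw [hc, h4] at hlt
    have hp5 : p < 5 := by
      by_contra hge
      push Not at hge
      have h7 : 4 ≤ p - 1 := by omega
      have := Nat.mul_le_mul (Nat.mul_le_mul_right p h7) h6
      omega
    have hker : Nat.card f.ker = p := by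
      have := card_eq_four_mul f hf
      rw [hc, h4] at this
      omega
    have hNK : N = f.ker := Subgroup.eq_of_le_of_card_ge hK (by rw [hker, hcN])
    have hcen : f.ker ≤ Subgroup.center G := by rw [← hNK]; exact hZ
    have hp2 := hp.two_le
    have hcases : p = 2 ∨ p = 3 := by
      have : p ≠ 4 := by rintro rfl; revert hp; decide
      omega
    rcases hcases with rfl | rfl
    · rcases order8 h f hf hcen hker with h | h | h
      · exact Or.inr (Or.inl h)
      · exact Or.inr (Or.inr (Or.inl h))
      · exact Or.inr (Or.inr (Or.inr (Or.inl h)))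
    · exact Or.inr (Or.inr (Or.inr (Or.inr (Or.inr (order12 h f hf hcen hker)))))

end final

end TwoGen


/-- Let `G` be a finite 2-generated group such that `C2 × C2` is an
epimorphic image of `G`. If the number of ordered pairs `(x, y) ∈ G × G` with
`⟨x, y⟩ = G` is strictly less than `6·|G|`, then `G` is isomorphic to one of:
`C2 × C2`, `C4 × C2`, `D4`, `Q8`, `D6`, or `C2 × C2 × C3`. -/
theorem stmt_10 {G : Type*} [Group G] [Finite G]
    (h2gen : ∃ a b : G, Subgroup.closure {a, b} = ⊤)
    (hepi : ∃ f : G →* Multiplicative (ZMod 2 × ZMod 2), Function.Surjective f)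
    (h : Nat.card {p : G × G | Subgroup.closure {p.1, p.2} = ⊤} < 6 * Nat.card G) :
    Nonempty (G ≃* Multiplicative (ZMod 2 × ZMod 2)) ∨
    Nonempty (G ≃* Multiplicative (ZMod 4 × ZMod 2)) ∨
    Nonempty (G ≃* DihedralGroup 4) ∨
    Nonempty (G ≃* QuaternionGroup 2) ∨
    Nonempty (G ≃* DihedralGroup 6) ∨
    Nonempty (G ≃* Multiplicative (ZMod 2 × ZMod 2 × ZMod 3)) := by
  obtain ⟨a, b, hab⟩ := h2gen
  obtain ⟨f, hf⟩ := hepi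
  exact TwoGen.main hab f hf h
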